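/- For Lebesgue-almost every irrational x ∈ (0,1), with P_n/Q_n the negative continued fraction convergents of x, one has limsup_{n→∞} (log n / n) · log Q_n(x) = π²/6 and liminf_{n→∞} (log n / n) · log |x − P_n(x)/Q_n(x)| = −π²/3. -/

import Mathlib

open MeasureTheory Filter Real

/-- The negative continued fraction map `T(y) = -1/y - ⌊-1/y⌋` (with `T 0 = 0`). -/
noncomputable def negT (y : ℝ) : ℝ := Int.fract (-1 / y)

/-- The `n`-th negative continued fraction digit `a'_n(x) = ⌈1 / T^{n-1}(1-x)⌉`. -/
noncomputable def negDigit (x : ℝ) (n : ℕ) : ℕ := (⌈1 / negT^[n - 1] (1 - x)⌉).toNat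

/-- Numerators of negative continued fraction convergents, shifted so that
`negP x (n+1) = P_n` with `P_{-1} = negP x 0 = 1`, `P_0 = negP x 1 = 1`,
`P_n = a'_n P_{n-1} - P_{n-2}`. -/
noncomputable def negP (x : ℝ) : ℕ → ℤ
  | 0 => 1
  | 1 => 1
  | n + 2 => negDigit x (n + 1) * negP x (n + 1) - negP x n

/-- Denominators of negative continued fraction convergents, shifted so that
`negQ x (n+1) = Q_n` with `Q_{-1} = negQ x 0 = 0`, `Q_0 = negQ x 1 = 1`,
`Q_n = a'_n Q_{n-1} - Q_{n-2}`. -/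
noncomputable def negQ (x : ℝ) : ℕ → ℤ
  | 0 => 0
  | 1 => 1
  | n + 2 => negDigit x (n + 1) * negQ x (n + 1) - negQ x n

open scoped ENNReal

/-- Weights of the transfer operator of the Gauss map, normalised by the Gauss density. -/
noncomputable def gaussW (k : ℕ) (y : ℝ) : ℝ := (1 + y) / ((k + 1 + y) * (k + 2 + y))

/-- The transfer operator of the Gauss map with respect to the Gauss measure. -/
noncomputable def gaussU (f : ℝ → ℝ) (y : ℝ) : ℝ := ∑' k : ℕ, gaussW k y * f (1 / (k + 1 + y))

theorem gaussW_nonneg (k : ℕ) {y : ℝ} (hy : 0 ≤ y) : 0 ≤ gaussW k y := by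
  unfold gaussW; positivity

theorem hasSum_gaussW {y : ℝ} (hy : 0 ≤ y) : HasSum (fun k => gaussW k y) 1 := by
  rw [hasSum_iff_tendsto_nat_of_nonneg (fun k => gaussW_nonneg k hy)]
  have h (n : ℕ) : ∑ k ∈ Finset.range n, gaussW k y = 1 - (1 + y) / (n + 1 + y) := by
    induction n with
    | zero => simp; field_simp; simp
    | succ n ih =>
      rw [Finset.sum_range_succ, ih, gaussW]
      push_cast
      field_simp
      ring
  simp_rw [h]
  have : Tendsto (fun n : ℕ => (1 + y) / ((n : ℝ) + 1 + y)) atTop (nhds 0) := by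
    apply Tendsto.div_atTop tendsto_const_nhds
    simp_rw [add_assoc]
    exact tendsto_atTop_add_const_right _ _ tendsto_natCast_atTop_atTop
  simpa using this.const_sub 1

theorem summable_gaussW_mul {y : ℝ} (hy : 0 ≤ y) {φ : ℕ → ℝ} {C : ℝ} (hφ : ∀ k, |φ k| ≤ C) :
    Summable (fun k => gaussW k y * φ k) := by
  refine Summable.of_norm_bounded ((hasSum_gaussW hy).summable.mul_right C) fun k => ?_
  rw [norm_mul, Real.norm_of_nonneg (gaussW_nonneg k hy)]
  exact mul_le_mul_of_nonneg_left (hφ k) (gaussW_nonneg k hy)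

theorem gaussW_sub_sign {a b : ℝ} (ha : 0 < a) (hab : a ≤ b) (hb : b < 1) :
    gaussW 0 b ≤ gaussW 0 a ∧ ∀ k, 2 ≤ k → gaussW k a ≤ gaussW k b := by
  have hb0 : 0 < b := ha.trans_le hab
  constructor
  · unfold gaussW
    rw [div_le_div_iff₀ (by positivity) (by positivity)]
    push_cast
    nlinarith [mul_pos ha ha, mul_nonneg (sub_nonneg.2 hab) ha.le,
      mul_nonneg (mul_nonneg (sub_nonneg.2 hab) ha.le) (ha.le.trans hab)]
  · intro k hk
    have hk' : (2 : ℝ) ≤ k := by exact_mod_cast hk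
    unfold gaussW
    rw [div_le_div_iff₀ (by positivity) (by positivity)]
    have : (1 + b) * ((k + 1 + a) * (k + 2 + a)) - (1 + a) * ((k + 1 + b) * (k + 2 + b))
      = (b - a) * ((k : ℝ) ^ 2 + k - (1 + a) * (1 + b)) := by ring
    have h2 : 0 ≤ (b - a) * ((k : ℝ) ^ 2 + k - (1 + a) * (1 + b)) := by
      apply mul_nonneg (by linarith)
      nlinarith
    linarith

theorem gaussW_succ_le {a b : ℝ} (ha : 0 < a) (hab : a ≤ b) (hb : b < 1) (k : ℕ) :
    gaussW (k + 1) a ≤ gaussW k b := by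
  have hb0 : 0 < b := ha.trans_le hab
  unfold gaussW
  push_cast
  apply div_le_div₀ (by linarith) (by linarith) (by positivity)
  apply mul_le_mul (by linarith) (by linarith) (by positivity) (by positivity)

theorem one_div_mem_Ioo (k : ℕ) {y : ℝ} (hy : y ∈ Set.Ioo (0 : ℝ) 1) :
    1 / ((k : ℝ) + 1 + y) ∈ Set.Ioo (0 : ℝ) 1 := by
  have := hy.1
  refine ⟨by positivity, ?_⟩
  rw [div_lt_one (by positivity)]
  have : (0 : ℝ) ≤ k := by positivity
  linarith

theorem summable_gaussU {f : ℝ → ℝ} {d : ℝ}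
    (hd : ∀ x ∈ Set.Ioo (0 : ℝ) 1, ∀ y ∈ Set.Ioo (0 : ℝ) 1, f x - f y ≤ d)
    {y : ℝ} (hy : y ∈ Set.Ioo (0 : ℝ) 1) :
    Summable (fun k : ℕ => gaussW k y * f (1 / (k + 1 + y))) := by
  refine summable_gaussW_mul hy.1.le (C := |f y| + d) fun k => ?_
  have h1 := hd _ (one_div_mem_Ioo k hy) _ hy
  have h2 := hd _ hy _ (one_div_mem_Ioo k hy)
  rw [abs_le]
  constructor <;> linarith [neg_abs_le (f y), le_abs_self (f y)]

theorem gaussU_antitone {f : ℝ → ℝ} {d : ℝ} (hf : AntitoneOn f (Set.Ioo 0 1))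
    (hd : ∀ x ∈ Set.Ioo (0 : ℝ) 1, ∀ y ∈ Set.Ioo (0 : ℝ) 1, f x - f y ≤ d) {a b : ℝ}
    (ha : a ∈ Set.Ioo (0 : ℝ) 1) (hb : b ∈ Set.Ioo (0 : ℝ) 1) (hab : a ≤ b) :
    gaussU f a ≤ gaussU f b ∧ gaussU f b - gaussU f a ≤ d / 2 := by
  have ha0 := ha.1
  have hb0 := hb.1
  set φ : ℕ → ℝ := fun k => f (1 / (k + 1 + a)) with hφ
  have hbd (k l : ℕ) : φ k - φ l ≤ d := hd _ (one_div_mem_Ioo k ha) _ (one_div_mem_Ioo l ha)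
  have hd0 : 0 ≤ d := by simpa using hbd 0 0
  have habs (k l : ℕ) : |φ k - φ l| ≤ d := abs_le.2 ⟨by linarith [hbd l k], hbd k l⟩
  have hmono (k l : ℕ) (h : k ≤ l) : φ k ≤ φ l := by
    apply hf (one_div_mem_Ioo l ha) (one_div_mem_Ioo k ha)
    have : (k : ℝ) ≤ l := by exact_mod_cast h
    apply one_div_le_one_div_of_le <;> [positivity; linarith]
  have hlow (k : ℕ) : φ k ≤ f (1 / (k + 1 + b)) := by
    apply hf (one_div_mem_Ioo k hb) (one_div_mem_Ioo k ha)
    apply one_div_le_one_div_of_le <;> [positivity; linarith]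
  have hup (k : ℕ) : f (1 / (k + 1 + b)) ≤ φ (k + 1) := by
    apply hf (one_div_mem_Ioo _ ha) (one_div_mem_Ioo k hb)
    have := hb.2
    apply one_div_le_one_div_of_le <;> [positivity; (push_cast; linarith)]
  have hsa (y : ℝ) (hy : 0 < y) (l : ℕ) : HasSum (fun k => gaussW k y * (φ k - φ l))
      (∑' k, gaussW k y * φ k - φ l) := by
    have h1 : Summable (fun k => gaussW k y * φ k) := by
      refine summable_gaussW_mul hy.le (C := |φ 0| + d) fun k => ?_
      have h1 := hbd k 0
      have h2 := hbd 0 k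
      rw [abs_le]
      constructor <;> linarith [neg_abs_le (φ 0), le_abs_self (φ 0)]
    have := h1.hasSum.sub ((hasSum_gaussW hy.le).mul_right (φ l))
    simpa [mul_sub] using this
  have hUa : gaussU f a = ∑' k, gaussW k a * φ k := rfl
  constructor
  · have h1 : gaussU f a ≤ ∑' k, gaussW k b * φ k := by
      have := (hsa b hb0 1).sub (hsa a ha0 1)
      rw [hUa]
      have h0 : 0 ≤ ∑' k, gaussW k b * φ k - φ 1 - (∑' k, gaussW k a * φ k - φ 1) := by
        refine this.nonneg fun k => ?_
        rw [← sub_mul]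
        obtain ⟨s1, s2⟩ := gaussW_sub_sign ha0 hab hb.2
        rcases Nat.lt_or_ge k 2 with hk | hk
        · interval_cases k
          · exact mul_nonneg_of_nonpos_of_nonpos (by linarith) (by linarith [hmono 0 1 (by simp)])
          · simp
        · exact mul_nonneg (by linarith [s2 k hk]) (by linarith [hmono 1 k (by omega)])
      linarith
    refine h1.trans ?_
    refine Summable.tsum_le_tsum (fun k => mul_le_mul_of_nonneg_left (hlow k)
      (gaussW_nonneg k hb0.le)) ?_ (summable_gaussU hd hb)
    simpa using ((hsa b hb0 0).summable.add ((hasSum_gaussW hb0.le).summable.mul_right (φ 0))).congr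
      (fun k => by ring)
  · have hA := hsa a ha0 0
    rw [← hasSum_nat_add_iff' 1] at hA
    simp only [Finset.range_one, Finset.sum_singleton, sub_self, mul_zero, sub_zero] at hA
    have hB : HasSum (fun k : ℕ => gaussW k b * (f (1 / (k + 1 + b)) - φ 0))
        (gaussU f b - φ 0) := by
      have := (summable_gaussU hd hb).hasSum.sub ((hasSum_gaussW hb0.le).mul_right (φ 0))
      simpa [mul_sub, gaussU] using this
    have hw := hasSum_gaussW ha0.le
    rw [← hasSum_nat_add_iff' 1] at hw
    simp only [Finset.range_one, Finset.sum_singleton] at hw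
    have hC := ((hasSum_gaussW hb0.le).sub hw).mul_right d
    have := hasSum_le (fun k => ?_) (hB.sub hA) hC
    · have h3 : gaussW 0 a ≤ 1 / 2 := by
        unfold gaussW
        rw [div_le_div_iff₀ (by positivity) (by positivity)]
        push_cast
        nlinarith
      rw [hUa]
      nlinarith
    · have h1 := gaussW_succ_le ha0 hab hb.2 k
      have h2 : gaussW k b * (f (1 / (k + 1 + b)) - φ 0) ≤ gaussW k b * (φ (k + 1) - φ 0) :=
        mul_le_mul_of_nonneg_left (by linarith [hup k]) (gaussW_nonneg k hb0.le)
      have h3 : (gaussW k b - gaussW (k + 1) a) * (φ (k + 1) - φ 0)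
        ≤ (gaussW k b - gaussW (k + 1) a) * d :=
        mul_le_mul_of_nonneg_left (hbd _ _) (by linarith)
      linarith

theorem gaussU_neg (f : ℝ → ℝ) (y : ℝ) : gaussU (fun x => -f x) y = -gaussU f y := by
  simp [gaussU, tsum_neg]

theorem gaussU_osc {f : ℝ → ℝ} {d : ℝ}
    (hf : AntitoneOn f (Set.Ioo 0 1) ∨ MonotoneOn f (Set.Ioo 0 1))
    (hd : ∀ x ∈ Set.Ioo (0 : ℝ) 1, ∀ y ∈ Set.Ioo (0 : ℝ) 1, f x - f y ≤ d) :
    (AntitoneOn (gaussU f) (Set.Ioo 0 1) ∨ MonotoneOn (gaussU f) (Set.Ioo 0 1)) ∧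
    ∀ x ∈ Set.Ioo (0 : ℝ) 1, ∀ y ∈ Set.Ioo (0 : ℝ) 1, gaussU f x - gaussU f y ≤ d / 2 := by
  have hd0 : 0 ≤ d := by simpa using hd (1 / 2) (by norm_num) (1 / 2) (by norm_num)
  rcases hf with hf | hf
  · have key := fun a ha b hb h => @gaussU_antitone f d hf hd a b ha hb h
    refine ⟨Or.inr fun a ha b hb h => (key a ha b hb h).1, fun x hx y hy => ?_⟩
    rcases le_total x y with h | h
    · linarith [(key x hx y hy h).1]
    · exact (key y hy x hx h).2
  · have key := fun a ha b hb h => @gaussU_antitone (fun x => -f x) d hf.neg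
      (fun x hx y hy => by linarith [hd y hy x hx]) a b ha hb h
    simp only [gaussU_neg] at key
    refine ⟨Or.inl fun a ha b hb h => by linarith [(key a ha b hb h).1], fun x hx y hy => ?_⟩
    rcases le_total x y with h | h
    · linarith [(key x hx y hy h).2]
    · linarith [(key y hy x hx h).1]

/-- The Gauss continued fraction map. -/
noncomputable def gaussMap (x : ℝ) : ℝ := Int.fract x⁻¹

/-- The density of the Gauss measure. -/
noncomputable def gaussDensity (x : ℝ) : ℝ := 1 / (Real.log 2 * (1 + x))

/-- The Gauss measure. -/
noncomputable def gaussMeasure : Measure ℝ :=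
  (volume.restrict (Set.Ioo (0 : ℝ) 1)).withDensity fun x => ENNReal.ofReal (gaussDensity x)

theorem measurable_gaussMap : Measurable gaussMap := measurable_inv.fract

theorem measurable_gaussDensity : Measurable gaussDensity := by
  unfold gaussDensity; fun_prop

theorem lintegral_gaussMeasure (F : ℝ → ℝ≥0∞) :
    ∫⁻ x, F x ∂gaussMeasure =
      ∫⁻ x in Set.Ioo (0 : ℝ) 1, ENNReal.ofReal (gaussDensity x) * F x := by
  rw [gaussMeasure, lintegral_withDensity_eq_lintegral_mul_non_measurable _
    measurable_gaussDensity.ennreal_ofReal (by simp)]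
  rfl

theorem ae_gaussMeasure_mem : ∀ᵐ x ∂gaussMeasure, x ∈ Set.Ioo (0 : ℝ) 1 :=
  (withDensity_absolutelyContinuous _ _).ae_le (ae_restrict_mem measurableSet_Ioo)

theorem ae_of_ae_gaussMeasure {p : ℝ → Prop} (h : ∀ᵐ x ∂gaussMeasure, p x) :
    ∀ᵐ x ∂(volume.restrict (Set.Ioo (0 : ℝ) 1)), p x := by
  rw [gaussMeasure, ae_withDensity_iff measurable_gaussDensity.ennreal_ofReal] at h
  filter_upwards [h, ae_restrict_mem measurableSet_Ioo] with x hx hx'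
  apply hx
  have := hx'.1
  have h2 := Real.log_pos one_lt_two
  simp only [ne_eq, ENNReal.ofReal_eq_zero, not_le, gaussDensity]
  positivity

theorem image_one_div_Ico (k : ℕ) : (fun y : ℝ => 1 / ((k : ℝ) + 1 + y)) '' Set.Ico 0 1 =
    Set.Ioc (1 / ((Nat.succ k : ℕ) + 1 : ℝ)) (1 / ((k : ℝ) + 1)) := by
  ext x
  simp only [Set.mem_image, Set.mem_Ico, Set.mem_Ioc]
  constructor
  · rintro ⟨y, ⟨hy0, hy1⟩, rfl⟩
    push_cast
    constructor
    · apply one_div_lt_one_div_of_lt <;> [positivity; linarith]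
    · apply one_div_le_one_div_of_le <;> [positivity; linarith]
  · rintro ⟨h1, h2⟩
    have hx : 0 < x := lt_trans (by positivity) h1
    refine ⟨1 / x - (k + 1), ⟨?_, ?_⟩, by simp⟩
    · rw [sub_nonneg, le_one_div (by positivity) hx]; exact h2
    · rw [sub_lt_iff_lt_add, one_div_lt hx (by positivity)]
      convert h1 using 2
      push_cast; ring

theorem iUnion_Ioc_one_div :
    (⋃ k : ℕ, Set.Ioc (1 / ((Nat.succ k : ℕ) + 1 : ℝ)) (1 / ((k : ℝ) + 1))) = Set.Ioc 0 1 := by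
  ext x
  simp only [Set.mem_iUnion, Set.mem_Ioc]
  constructor
  · rintro ⟨k, h1, h2⟩
    refine ⟨lt_trans (by positivity) h1, h2.trans ?_⟩
    rw [div_le_one (by positivity)]
    linarith [(Nat.cast_nonneg k : (0 : ℝ) ≤ k)]
  · rintro ⟨h1, h2⟩
    have h3 : 1 ≤ 1 / x := by rw [le_div_iff₀ h1]; linarith
    have h4 : 1 ≤ ⌊1 / x⌋₊ := by rwa [Nat.one_le_floor_iff]
    have h5 := Nat.floor_le (zero_le_one.trans h3)
    have h6 := Nat.lt_floor_add_one (1 / x)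
    obtain ⟨m, hm⟩ := Nat.exists_eq_add_of_le' h4
    rw [hm] at h5 h6
    push_cast at h5 h6
    refine ⟨m, ?_, ?_⟩
    · rw [one_div_lt (by positivity) h1]; push_cast; exact h6
    · rw [le_one_div h1 (by positivity)]; exact h5

theorem lintegral_Ioo_eq_tsum_branches (F : ℝ → ℝ≥0∞) :
    ∫⁻ x in Set.Ioo (0 : ℝ) 1, F x = ∑' k : ℕ, ∫⁻ y in Set.Ioo (0 : ℝ) 1,
      ENNReal.ofReal (1 / (k + 1 + y) ^ 2) * F (1 / (k + 1 + y)) := by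
  conv_lhs => rw [Measure.restrict_congr_set Ioo_ae_eq_Ioc, ← iUnion_Ioc_one_div]
  rw [lintegral_iUnion (fun _ => measurableSet_Ioc)]
  · congr 1
    ext k
    rw [← image_one_div_Ico, Measure.restrict_congr_set (Ioo_ae_eq_Ico (a := (0 : ℝ)) (b := 1)),
      lintegral_image_eq_lintegral_abs_deriv_mul (f' := fun y => -1 / ((k : ℝ) + 1 + y) ^ 2)
        measurableSet_Ico]
    · simp [abs_div]
    · intro y hy
      have h0 := hy.1
      have h1 : HasDerivAt (fun y : ℝ => (k : ℝ) + 1 + y) 1 y := (hasDerivAt_id y).const_add _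
      simp only [one_div]
      exact (h1.inv (by positivity)).hasDerivWithinAt
    · intro y hy z hz h
      simpa using h
  · refine Antitone.pairwise_disjoint_on_Ioc_succ (f := fun k : ℕ => 1 / ((k : ℝ) + 1)) ?_
    intro m n h
    have : (m : ℝ) ≤ n := by exact_mod_cast h
    exact one_div_le_one_div_of_le (by positivity) (by linarith)

theorem gaussMap_branch (k : ℕ) {y : ℝ} (hy : y ∈ Set.Ioo (0 : ℝ) 1) :
    gaussMap (1 / (k + 1 + y)) = y := by
  unfold gaussMap
  rw [one_div, inv_inv, show (k : ℝ) + 1 + y = y + (k + 1 : ℕ) by push_cast; ring,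
    Int.fract_add_natCast]
  exact Int.fract_eq_self.2 ⟨hy.1.le, hy.2⟩

theorem lintegral_mul_comp_gaussMap {f : ℝ → ℝ} {d : ℝ}
    (hf : AntitoneOn f (Set.Ioo 0 1) ∨ MonotoneOn f (Set.Ioo 0 1))
    (hf0 : ∀ x ∈ Set.Ioo (0 : ℝ) 1, 0 ≤ f x)
    (hd : ∀ x ∈ Set.Ioo (0 : ℝ) 1, ∀ y ∈ Set.Ioo (0 : ℝ) 1, f x - f y ≤ d)
    {g : ℝ → ℝ≥0∞} (hg : Measurable g) :
    ∫⁻ x, ENNReal.ofReal (f x) * g (gaussMap x) ∂gaussMeasure =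
      ∫⁻ y, ENNReal.ofReal (gaussU f y) * g y ∂gaussMeasure := by
  have hl := Real.log_pos one_lt_two
  rw [lintegral_gaussMeasure, lintegral_gaussMeasure, lintegral_Ioo_eq_tsum_branches,
    ← lintegral_tsum]
  · refine setLIntegral_congr_fun measurableSet_Ioo fun y hy => ?_
    have hy0 := hy.1
    simp only [gaussMap_branch _ hy]
    rw [gaussU, ENNReal.ofReal_tsum_of_nonneg _ (summable_gaussU hd hy), ← ENNReal.tsum_mul_right,
      ← ENNReal.tsum_mul_left]
    · congr 1
      ext k
      rw [← mul_assoc, ← mul_assoc, ← mul_assoc, ← ENNReal.ofReal_mul (by positivity),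
        ← ENNReal.ofReal_mul (by unfold gaussDensity; positivity),
        ← ENNReal.ofReal_mul (by unfold gaussDensity; positivity)]
      congr 2
      unfold gaussDensity gaussW
      field_simp
      ring
    · exact fun k => mul_nonneg (gaussW_nonneg k hy.1.le) (hf0 _ (one_div_mem_Ioo k hy))
  · intro k
    have h1 : AEMeasurable (fun y : ℝ => f (1 / (k + 1 + y)))
        (volume.restrict (Set.Ioo (0 : ℝ) 1)) := by
      have hanti : ∀ a ∈ Set.Ioo (0 : ℝ) 1, ∀ b ∈ Set.Ioo (0 : ℝ) 1, a ≤ b →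
          1 / ((k : ℝ) + 1 + b) ≤ 1 / ((k : ℝ) + 1 + a) := fun a ha b hb hab => by
        have := ha.1
        apply one_div_le_one_div_of_le <;> [positivity; linarith]
      rcases hf with hf | hf
      · exact aemeasurable_restrict_of_monotoneOn measurableSet_Ioo fun a ha b hb hab =>
          hf (one_div_mem_Ioo k hb) (one_div_mem_Ioo k ha) (hanti a ha b hb hab)
      · exact aemeasurable_restrict_of_antitoneOn measurableSet_Ioo fun a ha b hb hab =>
          hf (one_div_mem_Ioo k hb) (one_div_mem_Ioo k ha) (hanti a ha b hb hab)
    have h2 : Measurable fun y : ℝ => 1 / ((k : ℝ) + 1 + y) := by fun_prop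
    refine AEMeasurable.mul ?_ (AEMeasurable.mul ?_ (AEMeasurable.mul h1.ennreal_ofReal ?_))
    · exact Measurable.aemeasurable (by fun_prop)
    · exact (measurable_gaussDensity.comp h2).ennreal_ofReal.aemeasurable
    · exact (hg.comp (measurable_gaussMap.comp h2)).aemeasurable

theorem gaussU_const (c : ℝ) {y : ℝ} (hy : y ∈ Set.Ioo (0 : ℝ) 1) :
    gaussU (fun _ => c) y = c := by
  simpa [gaussU] using ((hasSum_gaussW hy.1.le).mul_right c).tsum_eq

theorem measurePreserving_gaussMap : MeasurePreserving gaussMap gaussMeasure gaussMeasure := by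
  refine ⟨measurable_gaussMap, ?_⟩
  ext s hs
  have := lintegral_mul_comp_gaussMap (f := fun _ => 1) (d := 0) (Or.inl fun _ _ _ _ _ => le_rfl)
    (by simp) (by simp) (g := s.indicator 1) (measurable_one.indicator hs)
  rw [Measure.map_apply measurable_gaussMap hs, ← lintegral_indicator_one hs,
    ← lintegral_indicator_one (measurable_gaussMap hs)]
  convert this using 1
  · simp; rfl
  · refine lintegral_congr_ae ?_
    filter_upwards [ae_gaussMeasure_mem] with y hy
    simp [gaussU_const _ hy]

theorem gaussMeasure_Iic {t : ℝ} (ht0 : 0 ≤ t) (ht : t ≤ 1) :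
    gaussMeasure (Set.Iic t) = ENNReal.ofReal (Real.log (1 + t) / Real.log 2) := by
  have hl := Real.log_pos one_lt_two
  rw [← lintegral_indicator_one measurableSet_Iic, lintegral_gaussMeasure]
  have h1 : ∫⁻ x in Set.Ioo (0 : ℝ) 1, ENNReal.ofReal (gaussDensity x) * (Set.Iic t).indicator 1 x
      = ∫⁻ x in Set.Ioc 0 t, ENNReal.ofReal (gaussDensity x) := by
    rw [Measure.restrict_congr_set Ioo_ae_eq_Ioc, ← Set.inter_eq_self_of_subset_right
      (Set.Ioc_subset_Ioc_right ht : Set.Ioc (0 : ℝ) t ⊆ Set.Ioc 0 1)]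
    rw [show (Set.Ioc (0 : ℝ) 1 ∩ Set.Ioc 0 t) = Set.Iic t ∩ Set.Ioc 0 1 by
      ext x; simp only [Set.mem_inter_iff, Set.mem_Ioc, Set.mem_Iic]; grind,
      ← Measure.restrict_restrict measurableSet_Iic, ← lintegral_indicator measurableSet_Iic]
    refine lintegral_congr fun x => ?_
    by_cases hx : x ∈ Set.Iic t <;> simp [hx]
  have hderiv : ∀ x ∈ Set.uIcc 0 t, HasDerivAt (fun x => Real.log (1 + x) / Real.log 2)
      (gaussDensity x) x := by
    intro x hx
    rw [Set.uIcc_of_le ht0] at hx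
    have h3 : HasDerivAt (fun x : ℝ => 1 + x) 1 x := (hasDerivAt_id x).const_add _
    have hx0 := hx.1
    refine ((h3.log (by positivity)).div_const (Real.log 2)).congr_deriv ?_
    unfold gaussDensity
    field_simp
  have hcont : ContinuousOn gaussDensity (Set.uIcc 0 t) := by
    rw [Set.uIcc_of_le ht0]
    unfold gaussDensity
    apply ContinuousOn.div (by fun_prop) (by fun_prop)
    intro x hx
    have hx0 := hx.1
    positivity
  have h2 := intervalIntegral.integral_eq_sub_of_hasDerivAt hderiv hcont.intervalIntegrable
  rw [h1, ← ofReal_integral_eq_lintegral_ofReal, ← intervalIntegral.integral_of_le ht0, h2]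
  · simp
  · exact (hcont.intervalIntegrable (μ := volume)).1
  · filter_upwards [ae_restrict_mem measurableSet_Ioc] with x hx
    have hx0 := hx.1
    simp only [Pi.zero_apply, gaussDensity]
    positivity

instance : IsProbabilityMeasure gaussMeasure := by
  constructor
  have h := gaussMeasure_Iic zero_le_one le_rfl
  have hl := Real.log_pos one_lt_two
  rw [one_add_one_eq_two, div_self hl.ne', ENNReal.ofReal_one] at h
  rw [← h]
  refine measure_congr ?_
  filter_upwards [ae_gaussMeasure_mem] with y hy
  apply propext
  exact ⟨fun _ => hy.2.le, fun _ => trivial⟩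

theorem lintegral_mul_comp_iterate_le (n : ℕ) : ∀ {f : ℝ → ℝ} {d : ℝ},
    (AntitoneOn f (Set.Ioo 0 1) ∨ MonotoneOn f (Set.Ioo 0 1)) →
    (∀ x ∈ Set.Ioo (0 : ℝ) 1, 0 ≤ f x) →
    (∀ x ∈ Set.Ioo (0 : ℝ) 1, ∀ y ∈ Set.Ioo (0 : ℝ) 1, f x - f y ≤ d) →
    ∀ {g : ℝ → ℝ≥0∞}, Measurable g →
    ∫⁻ x, ENNReal.ofReal (f x) * g (gaussMap^[n] x) ∂gaussMeasure ≤
      (∫⁻ x, ENNReal.ofReal (f x) ∂gaussMeasure + ENNReal.ofReal (d / 2 ^ n)) *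
        ∫⁻ x, g x ∂gaussMeasure := by
  induction n with
  | zero =>
    intro f d hf hf0 hd g hg
    rw [← lintegral_const_mul _ hg]
    refine lintegral_mono_ae ?_
    filter_upwards [ae_gaussMeasure_mem] with x hx
    simp only [Function.iterate_zero, id, pow_zero, div_one]
    gcongr
    have h1 : ∫⁻ y, ENNReal.ofReal (f x) ∂gaussMeasure ≤
        ∫⁻ y, (ENNReal.ofReal (f y) + ENNReal.ofReal d) ∂gaussMeasure := by
      refine lintegral_mono_ae ?_
      filter_upwards [ae_gaussMeasure_mem] with y hy
      refine (ENNReal.ofReal_le_ofReal ?_).trans ENNReal.ofReal_add_le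
      linarith [hd x hx y hy]
    rw [lintegral_add_right _ measurable_const] at h1
    simpa using h1
  | succ n ih =>
    intro f d hf hf0 hd g hg
    have h1 := lintegral_mul_comp_gaussMap hf hf0 hd
      (hg.comp (measurable_gaussMap.iterate n))
    have h2 := lintegral_mul_comp_gaussMap hf hf0 hd (g := fun _ => 1) measurable_const
    simp only [mul_one] at h2
    obtain ⟨h3, h4⟩ := gaussU_osc hf hd
    have h5 : ∀ x ∈ Set.Ioo (0 : ℝ) 1, 0 ≤ gaussU f x := fun x hx =>
      tsum_nonneg fun k => mul_nonneg (gaussW_nonneg k hx.1.le) (hf0 _ (one_div_mem_Ioo k hx))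
    have h6 := ih h3 h5 h4 hg
    rw [h2, pow_succ', ← div_div]
    simp only [Function.comp_apply, ← Function.iterate_succ_apply] at h1
    rw [h1]
    exact h6

theorem ae_iterate_mem : ∀ᵐ x ∂gaussMeasure, ∀ i, gaussMap^[i] x ∈ Set.Ioo (0 : ℝ) 1 :=
  ae_all_iff.2 fun i =>
    (measurePreserving_gaussMap.iterate i).quasiMeasurePreserving.ae ae_gaussMeasure_mem

section Variance

variable {g : ℝ → ℝ} {N : ℝ}

theorem memLp_comp_iterate (hg : Measurable g) (hg0 : ∀ x ∈ Set.Ioo (0 : ℝ) 1, 0 ≤ g x)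
    (hgN : ∀ x ∈ Set.Ioo (0 : ℝ) 1, g x ≤ N) (i : ℕ) :
    MemLp (fun x => g (gaussMap^[i] x)) 2 gaussMeasure := by
  refine MemLp.of_bound (hg.comp (measurable_gaussMap.iterate i)).aestronglyMeasurable N ?_
  filter_upwards [ae_iterate_mem] with x hx
  rw [Real.norm_of_nonneg (hg0 _ (hx i))]
  exact hgN _ (hx i)

theorem integral_comp_iterate (hg : Measurable g) (i : ℕ) :
    ∫ x, g (gaussMap^[i] x) ∂gaussMeasure = ∫ x, g x ∂gaussMeasure := by
  have h := measurePreserving_gaussMap.iterate i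
  conv_rhs => rw [← h.map_eq]
  rw [integral_map h.measurable.aemeasurable hg.aestronglyMeasurable]

theorem integral_mul_iterate_le (hg : Measurable g)
    (hmono : AntitoneOn g (Set.Ioo 0 1) ∨ MonotoneOn g (Set.Ioo 0 1))
    (hg0 : ∀ x ∈ Set.Ioo (0 : ℝ) 1, 0 ≤ g x)
    (hgN : ∀ x ∈ Set.Ioo (0 : ℝ) 1, g x ≤ N) {i j : ℕ} (hij : i ≤ j) :
    ∫ x, g (gaussMap^[i] x) * g (gaussMap^[j] x) ∂gaussMeasure ≤
      (∫ x, g x ∂gaussMeasure) ^ 2 + N * (∫ x, g x ∂gaussMeasure) * (1 / 2) ^ (j - i) := by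
  have hN : 0 ≤ N := (hg0 (1 / 2) (by norm_num)).trans (hgN (1 / 2) (by norm_num))
  have hnn : 0 ≤ᵐ[gaussMeasure] g := by
    filter_upwards [ae_gaussMeasure_mem] with x hx using hg0 x hx
  have h_int : Integrable g gaussMeasure := by
    have := memLp_comp_iterate hg hg0 hgN 0
    exact this.integrable one_le_two
  have hE : 0 ≤ ∫ x, g x ∂gaussMeasure := integral_nonneg_of_ae hnn
  obtain ⟨k, rfl⟩ := Nat.exists_eq_add_of_le hij
  have h1 : ∫ x, g (gaussMap^[i] x) * g (gaussMap^[i + k] x) ∂gaussMeasure =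
      ∫ x, g x * g (gaussMap^[k] x) ∂gaussMeasure := by
    rw [← integral_comp_iterate (g := fun x => g x * g (gaussMap^[k] x))
      (hg.mul (hg.comp (measurable_gaussMap.iterate k))) i]
    simp only [← Function.iterate_add_apply, add_comm]
  have hmul : Integrable (fun x => g x * g (gaussMap^[k] x)) gaussMeasure :=
    (memLp_comp_iterate hg hg0 hgN 0).integrable_mul (memLp_comp_iterate hg hg0 hgN k)
  rw [h1, Nat.add_sub_cancel_left, ← ENNReal.ofReal_le_ofReal_iff (by positivity),
    ofReal_integral_eq_lintegral_ofReal hmul]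
  · have h2 := lintegral_mul_comp_iterate_le k hmono hg0 (d := N)
      (fun x hx y hy => by linarith [hgN x hx, hg0 y hy]) (g := fun x => ENNReal.ofReal (g x))
      hg.ennreal_ofReal
    rw [← ofReal_integral_eq_lintegral_ofReal h_int hnn, ← ENNReal.ofReal_add hE (by positivity),
      ← ENNReal.ofReal_mul (by positivity)] at h2
    convert h2 using 1
    · refine lintegral_congr_ae ?_
      filter_upwards [ae_gaussMeasure_mem] with x hx
      rw [ENNReal.ofReal_mul (hg0 x hx)]
    · congr 1
      rw [one_div, inv_pow]
      ring
  · filter_upwards [ae_iterate_mem] with x hx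
    exact mul_nonneg (hg0 _ (hx 0)) (hg0 _ (hx k))

theorem sum_half_pow_dist_le (I : Finset ℕ) (i : ℕ) :
    ∑ j ∈ I, (1 / 2 : ℝ) ^ ((i - j) + (j - i)) ≤ 4 := by
  have hg : ∀ s : Finset ℕ, ∀ φ : ℕ → ℕ, Set.InjOn φ s → ∑ j ∈ s, (1 / 2 : ℝ) ^ φ j ≤ 2 := by
    intro s φ hφ
    rw [← Finset.sum_image (f := fun n => (1 / 2 : ℝ) ^ n) hφ]
    exact (summable_geometric_two.sum_le_tsum _ fun _ _ => by positivity).trans_eq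
      tsum_geometric_two
  rw [← Finset.sum_filter_add_sum_filter_not I (fun j => j ≤ i)]
  have h1 := hg (I.filter fun j => j ≤ i) (fun j => (i - j) + (j - i)) (by
    intro a ha b hb h
    simp at ha hb h
    omega)
  have h2 := hg (I.filter fun j => ¬ j ≤ i) (fun j => (i - j) + (j - i)) (by
    intro a ha b hb h
    simp at ha hb h
    omega)
  linarith

theorem measure_sum_iterate_ge_le (hg : Measurable g)
    (hmono : AntitoneOn g (Set.Ioo 0 1) ∨ MonotoneOn g (Set.Ioo 0 1))
    (hg0 : ∀ x ∈ Set.Ioo (0 : ℝ) 1, 0 ≤ g x)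
    (hgN : ∀ x ∈ Set.Ioo (0 : ℝ) 1, g x ≤ N) (I : Finset ℕ) {t : ℝ} (ht : 0 < t) :
    gaussMeasure {x | t ≤ |∑ i ∈ I, g (gaussMap^[i] x) - I.card * ∫ x, g x ∂gaussMeasure|} ≤
      ENNReal.ofReal (4 * I.card * N * (∫ x, g x ∂gaussMeasure) / t ^ 2) := by
  have hN : 0 ≤ N := (hg0 (1 / 2) (by norm_num)).trans (hgN (1 / 2) (by norm_num))
  have hE : 0 ≤ ∫ x, g x ∂gaussMeasure := integral_nonneg_of_ae (by
    filter_upwards [ae_gaussMeasure_mem] with x hx using hg0 x hx)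
  set E := ∫ x, g x ∂gaussMeasure with hEdef
  have hL := memLp_comp_iterate hg hg0 hgN
  have hS : MemLp (fun x => ∑ i ∈ I, g (gaussMap^[i] x)) 2 gaussMeasure :=
    memLp_finsetSum _ fun i _ => hL i
  have hmean : ∫ x, ∑ i ∈ I, g (gaussMap^[i] x) ∂gaussMeasure = I.card * E := by
    rw [integral_finsetSum _ fun i _ => (hL i).integrable one_le_two]
    simp [integral_comp_iterate hg, hEdef]
  have hcheb := ProbabilityTheory.meas_ge_le_variance_div_sq hS ht
  rw [hmean] at hcheb
  refine hcheb.trans (ENNReal.ofReal_le_ofReal ?_)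
  gcongr
  rw [ProbabilityTheory.variance_eq_sub hS, hmean]
  have hpair (i j : ℕ) : ∫ x, g (gaussMap^[i] x) * g (gaussMap^[j] x) ∂gaussMeasure ≤
      E ^ 2 + N * E * (1 / 2) ^ ((i - j) + (j - i)) := by
    rcases le_total i j with h | h
    · simpa [Nat.sub_eq_zero_of_le h] using integral_mul_iterate_le hg hmono hg0 hgN h
    · simpa [Nat.sub_eq_zero_of_le h, mul_comm (g (gaussMap^[i] _))] using
        integral_mul_iterate_le hg hmono hg0 hgN h
  have hsq : ∫ x, ((fun x => ∑ i ∈ I, g (gaussMap^[i] x)) ^ 2) x ∂gaussMeasure =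
      ∑ i ∈ I, ∑ j ∈ I, ∫ x, g (gaussMap^[i] x) * g (gaussMap^[j] x) ∂gaussMeasure := by
    have hprod (i j : ℕ) : Integrable (fun x => g (gaussMap^[i] x) * g (gaussMap^[j] x))
        gaussMeasure := (hL i).integrable_mul (hL j)
    simp only [Pi.pow_apply, sq, Finset.sum_mul_sum]
    rw [integral_finsetSum _ fun i _ => integrable_finsetSum _ fun j _ => hprod i j]
    exact Finset.sum_congr rfl fun i _ => integral_finsetSum _ fun j _ => hprod i j
  rw [hsq]
  have h1 : ∑ i ∈ I, ∑ j ∈ I, ∫ x, g (gaussMap^[i] x) * g (gaussMap^[j] x) ∂gaussMeasure ≤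
      ∑ i ∈ I, (I.card * E ^ 2 + N * E * 4) := by
    refine Finset.sum_le_sum fun i _ => ?_
    refine (Finset.sum_le_sum fun j _ => hpair i j).trans ?_
    rw [Finset.sum_add_distrib, ← Finset.mul_sum]
    have := sum_half_pow_dist_le I i
    have h2 : N * E * ∑ j ∈ I, (1 / 2 : ℝ) ^ ((i - j) + (j - i)) ≤ N * E * 4 := by gcongr
    simpa using h2
  simp only [Finset.sum_const, nsmul_eq_mul] at h1
  linarith

end Variance

theorem ae_eventually_abs_sum_iterate_sub_lt {g : ℕ → ℝ → ℝ} {N E t : ℕ → ℝ} {I : ℕ → Finset ℕ}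
    (hg : ∀ j, Measurable (g j)) (hmono : ∀ j, AntitoneOn (g j) (Set.Ioo 0 1))
    (hg0 : ∀ j, ∀ x ∈ Set.Ioo (0 : ℝ) 1, 0 ≤ g j x)
    (hgN : ∀ j, ∀ x ∈ Set.Ioo (0 : ℝ) 1, g j x ≤ N j)
    (hE : ∀ j, ∫ x, g j x ∂gaussMeasure = E j) (ht : ∀ᶠ j in atTop, 0 < t j)
    (hs : Summable fun j => (I j).card * N j * E j / t j ^ 2) :
    ∀ᵐ x ∂gaussMeasure, ∀ᶠ j in atTop,
      |∑ i ∈ I j, g j (gaussMap^[i] x) - (I j).card * E j| < t j := by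
  have key : ∑' j, gaussMeasure {x | 0 < t j ∧
      t j ≤ |∑ i ∈ I j, g j (gaussMap^[i] x) - (I j).card * E j|} ≠ ∞ := by
    refine ne_top_of_le_ne_top (hs.mul_left 4).tsum_ofReal_ne_top (ENNReal.tsum_le_tsum fun j => ?_)
    by_cases h : 0 < t j
    · simp only [h, true_and]
      have := measure_sum_iterate_ge_le (hg j) (Or.inl (hmono j)) (hg0 j) (hgN j) (I j) h
      rw [hE j] at this
      convert this using 2
      ring
    · simp [h]
  filter_upwards [ae_eventually_notMem key] with x hx
  filter_upwards [hx, ht] with j h1 h2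
  simp only [not_and, not_le] at h1
  exact h1 h2

theorem ae_eventually_forall_iterate_gt {s : ℕ → ℝ} {I : ℕ → Finset ℕ}
    (hs0 : ∀ j, 0 ≤ s j) (hs1 : ∀ j, s j ≤ 1) (hs : Summable fun j => (I j).card * s j) :
    ∀ᵐ x ∂gaussMeasure, ∀ᶠ j in atTop, ∀ i ∈ I j, s j < gaussMap^[i] x := by
  have hl := Real.log_pos one_lt_two
  have key : ∑' j, gaussMeasure (⋃ i ∈ I j, gaussMap^[i] ⁻¹' Set.Iic (s j)) ≠ ∞ := by
    refine ne_top_of_le_ne_top (hs.mul_left (1 / Real.log 2)).tsum_ofReal_ne_top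
      (ENNReal.tsum_le_tsum fun j => ?_)
    refine (measure_biUnion_finset_le _ _).trans ?_
    simp only [(measurePreserving_gaussMap.iterate _).measure_preimage
      measurableSet_Iic.nullMeasurableSet, gaussMeasure_Iic (hs0 j) (hs1 j), Finset.sum_const,
      nsmul_eq_mul]
    rw [← ENNReal.ofReal_natCast, ← ENNReal.ofReal_mul (by positivity)]
    apply ENNReal.ofReal_le_ofReal
    have : Real.log (1 + s j) ≤ s j := by
      linarith [Real.log_le_sub_one_of_pos (by linarith [hs0 j] : 0 < 1 + s j)]
    calc ((I j).card : ℝ) * (Real.log (1 + s j) / Real.log 2)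
        ≤ (I j).card * (s j / Real.log 2) := by gcongr
      _ = _ := by ring
  filter_upwards [ae_eventually_notMem key] with x hx
  filter_upwards [hx] with j h1
  simpa using h1

/-- The first regular continued fraction digit. -/
noncomputable def gaussDigit (x : ℝ) : ℕ := ⌊x⁻¹⌋₊

theorem measurable_gaussDigit : Measurable gaussDigit := Nat.measurable_floor.comp measurable_inv

theorem lt_gaussDigit_iff {x : ℝ} (hx : 0 < x) (m : ℕ) :
    m < gaussDigit x ↔ x ≤ 1 / (m + 1) := by
  rw [gaussDigit, Nat.lt_iff_add_one_le, Nat.le_floor_iff (by positivity),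
    ← one_div, le_div_comm₀ (by positivity) hx]
  push_cast
  rfl

theorem gaussDigit_antitoneOn : AntitoneOn gaussDigit (Set.Ioo 0 1) := by
  intro a ha b hb hab
  have := ha.1
  exact Nat.floor_le_floor (inv_anti₀ ha.1 hab)

theorem integral_min_gaussDigit (N : ℕ) :
    ∫ x, ((min (gaussDigit x) N : ℕ) : ℝ) ∂gaussMeasure = Real.log (N + 1) / Real.log 2 := by
  have h1 : ∫ x, ((min (gaussDigit x) N : ℕ) : ℝ) ∂gaussMeasure =
      ∫ x, ∑ m ∈ Finset.range N, (Set.Iic (1 / ((m : ℝ) + 1))).indicator 1 x ∂gaussMeasure := by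
    refine integral_congr_ae ?_
    filter_upwards [ae_gaussMeasure_mem] with x hx
    simp only [Set.indicator_apply, Set.mem_Iic, ← lt_gaussDigit_iff hx.1, Pi.one_apply]
    rw [Finset.sum_boole]
    congr 1
    rw [show (Finset.range N).filter (fun m => m < gaussDigit x) =
      Finset.range (min (gaussDigit x) N) by ext; simp; tauto, Finset.card_range]
  rw [h1, integral_finsetSum]
  · have h2 (m : ℕ) : ∫ x, (Set.Iic (1 / ((m : ℝ) + 1))).indicator 1 x ∂gaussMeasure =
        (Real.log ((m + 1 : ℕ) + 1) - Real.log (m + 1)) / Real.log 2 := by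
      have h3 : 1 / ((m : ℝ) + 1) ≤ 1 := by
        rw [div_le_one (by positivity)]; linarith [(Nat.cast_nonneg m : (0 : ℝ) ≤ m)]
      have hl := Real.log_pos one_lt_two
      rw [integral_indicator_one measurableSet_Iic, Measure.real,
        gaussMeasure_Iic (by positivity) h3, ENNReal.toReal_ofReal, ← Real.log_div]
      · congr 2
        push_cast
        field_simp
      · positivity
      · positivity
      · have : 0 ≤ Real.log (1 + 1 / ((m : ℝ) + 1)) := Real.log_nonneg (by
          have : 0 ≤ 1 / ((m : ℝ) + 1) := by positivity
          linarith)
        positivity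
    simp only [h2]
    rw [← Finset.sum_div, Finset.sum_range_sub (fun m : ℕ => Real.log ((m : ℝ) + 1))]
    simp
  · intro m _
    exact (integrable_const (1 : ℝ)).indicator measurableSet_Iic

theorem lintegral_pow_mul_neg_log (n : ℕ) :
    ∫⁻ x in Set.Ioo (0 : ℝ) 1, ENNReal.ofReal (x ^ n * (-Real.log x)) =
      ENNReal.ofReal (1 / ((n : ℝ) + 1) ^ 2) := by
  set F : ℝ → ℝ := fun x => x ^ n * (-(x * Real.log x)) / (n + 1) + x ^ (n + 1) / (n + 1) ^ 2
  have hcont : Continuous F := by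
    have := Real.continuous_mul_log
    fun_prop
  have hderiv : ∀ x ∈ Set.Ioo (0 : ℝ) 1, HasDerivAt F (x ^ n * (-Real.log x)) x := by
    intro x hx
    have h0 := hx.1
    have h1 : HasDerivAt (fun x : ℝ => x ^ n * (-(x * Real.log x))) _ x :=
      (hasDerivAt_pow n x).mul ((hasDerivAt_id x).mul (Real.hasDerivAt_log h0.ne')).neg
    refine ((h1.div_const ((n : ℝ) + 1)).add
      ((hasDerivAt_pow (n + 1) x).div_const (((n : ℝ) + 1) ^ 2))).congr_deriv ?_
    rcases n with _ | n
    · simp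
      field_simp
      ring
    · push_cast
      simp
      field_simp
      ring
  have hnn : ∀ x ∈ Set.Ioo (0 : ℝ) 1, 0 ≤ x ^ n * (-Real.log x) := fun x hx => by
    have h1 := Real.log_nonpos hx.1.le hx.2.le
    have h0 := hx.1
    exact mul_nonneg (by positivity) (by linarith)
  have h_int := intervalIntegral.integrableOn_deriv_of_nonneg hcont.continuousOn hderiv hnn
  have h2 := intervalIntegral.integral_eq_sub_of_hasDerivAt_of_le zero_le_one hcont.continuousOn
    hderiv ((intervalIntegrable_iff_integrableOn_Ioc_of_le zero_le_one).2 h_int)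
  rw [← ofReal_integral_eq_lintegral_ofReal (h_int.mono_set Set.Ioo_subset_Ioc_self),
    ← integral_Ioc_eq_integral_Ioo, ← intervalIntegral.integral_of_le zero_le_one, h2]
  · simp [F]
  · filter_upwards [ae_restrict_mem measurableSet_Ioo] with x hx using hnn x hx

theorem hasSum_inv_sq_alternating :
    HasSum (fun n : ℕ => 1 / ((2 * n : ℕ) + 1 : ℝ) ^ 2 - 1 / ((2 * n + 1 : ℕ) + 1 : ℝ) ^ 2)
      (π ^ 2 / 12) := by
  have hz := hasSum_zeta_two
  set f : ℕ → ℝ := fun n => 1 / (n : ℝ) ^ 2 with hf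
  have he : HasSum (fun n : ℕ => f (2 * n)) (π ^ 2 / 24) := by
    have h := hz.mul_left (1 / 4 : ℝ)
    rw [show (1 / 4 : ℝ) * (π ^ 2 / 6) = π ^ 2 / 24 by ring] at h
    have h2 : (fun n : ℕ => f (2 * n)) = fun n => 1 / 4 * f n := by
      ext n
      simp only [hf]
      push_cast
      rw [mul_pow, one_div_mul_one_div]
      norm_num
    rw [h2]
    exact h
  have ho : Summable (fun n : ℕ => f (2 * n + 1)) :=
    hz.summable.comp_injective (i := fun n : ℕ => 2 * n + 1) fun a b h => by simpa using h
  have h1 := (he.even_add_odd ho.hasSum).unique hz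
  have ho' := ho.hasSum
  rw [show ∑' n : ℕ, f (2 * n + 1) = π ^ 2 / 8 by linarith] at ho'
  have he' : HasSum (fun n : ℕ => f (2 * (n + 1))) (π ^ 2 / 24) := by
    have h := (hasSum_nat_add_iff' 1).2 he
    simpa [hf] using h
  have h2 := ho'.sub he'
  rw [show π ^ 2 / 8 - π ^ 2 / 24 = π ^ 2 / 12 by ring] at h2
  refine h2.congr_fun ?_
  intro n
  simp only [hf]
  push_cast
  ring

theorem lintegral_neg_log_gaussMeasure :
    ∫⁻ x, ENNReal.ofReal (-Real.log x) ∂gaussMeasure =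
      ENNReal.ofReal (π ^ 2 / (12 * Real.log 2)) := by
  have hl := Real.log_pos one_lt_two
  have hs := hasSum_inv_sq_alternating
  have hterm (n : ℕ) : ∫⁻ x in Set.Ioo (0 : ℝ) 1,
      ENNReal.ofReal ((1 - x) * (x ^ 2) ^ n * (-Real.log x)) =
      ENNReal.ofReal (1 / ((2 * n : ℕ) + 1 : ℝ) ^ 2 - 1 / ((2 * n + 1 : ℕ) + 1 : ℝ) ^ 2) := by
    rw [ENNReal.ofReal_sub _ (by positivity), ← lintegral_pow_mul_neg_log,
      ← lintegral_pow_mul_neg_log, ← lintegral_sub]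
    · refine setLIntegral_congr_fun measurableSet_Ioo fun x hx => ?_
      have h1 := Real.log_nonpos hx.1.le hx.2.le
      have h0 := hx.1
      rw [← ENNReal.ofReal_sub _ (mul_nonneg (by positivity) (by linarith))]
      congr 1
      ring
    · exact Measurable.ennreal_ofReal (by fun_prop)
    · rw [lintegral_pow_mul_neg_log]; exact ENNReal.ofReal_ne_top
    · filter_upwards [ae_restrict_mem measurableSet_Ioo] with x hx
      have h1 := Real.log_nonpos hx.1.le hx.2.le
      apply ENNReal.ofReal_le_ofReal
      apply mul_le_mul_of_nonneg_right _ (by linarith)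
      exact pow_le_pow_of_le_one hx.1.le hx.2.le (by omega)
  have hnn (n : ℕ) : 0 ≤ 1 / ((2 * n : ℕ) + 1 : ℝ) ^ 2 - 1 / ((2 * n + 1 : ℕ) + 1 : ℝ) ^ 2 := by
    rw [sub_nonneg]
    apply one_div_le_one_div_of_le (by positivity)
    push_cast
    gcongr
    linarith
  calc ∫⁻ x, ENNReal.ofReal (-Real.log x) ∂gaussMeasure
      = ∫⁻ x in Set.Ioo (0 : ℝ) 1, ENNReal.ofReal (1 / Real.log 2) *
          ∑' n : ℕ, ENNReal.ofReal ((1 - x) * (x ^ 2) ^ n * (-Real.log x)) := by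
        rw [lintegral_gaussMeasure]
        refine setLIntegral_congr_fun measurableSet_Ioo fun x hx => ?_
        have h1 := Real.log_nonpos hx.1.le hx.2.le
        have h0 := hx.1
        have h2 := hx.2
        have hx2 : x ^ 2 < 1 := by nlinarith
        have hg := ((hasSum_geometric_of_lt_one (sq_nonneg x) hx2).mul_left (1 - x)).mul_right
          (-Real.log x)
        rw [← ENNReal.ofReal_tsum_of_nonneg _ hg.summable, hg.tsum_eq,
          ← ENNReal.ofReal_mul (by unfold gaussDensity; positivity),
          ← ENNReal.ofReal_mul (by positivity)]
        · congr 1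
          unfold gaussDensity
          have h3 : 1 - x ^ 2 = (1 - x) * (1 + x) := by ring
          have h4 : 1 - x ≠ 0 := by linarith
          rw [h3]
          field_simp
        · intro n
          have h4 : 0 ≤ 1 - x := by linarith
          exact mul_nonneg (by positivity) (by linarith)
    _ = ENNReal.ofReal (1 / Real.log 2) * ∑' n : ℕ,
          ENNReal.ofReal (1 / ((2 * n : ℕ) + 1 : ℝ) ^ 2 - 1 / ((2 * n + 1 : ℕ) + 1 : ℝ) ^ 2) := by
        rw [lintegral_const_mul' _ _ ENNReal.ofReal_ne_top, lintegral_tsum]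
        · simp only [hterm]
        · intro n
          exact (Measurable.ennreal_ofReal (by fun_prop)).aemeasurable
    _ = _ := by
        rw [← ENNReal.ofReal_tsum_of_nonneg hnn hs.summable, hs.tsum_eq,
          ← ENNReal.ofReal_mul (by positivity)]
        congr 1
        field_simp

theorem tendsto_integral_min_neg_log :
    Tendsto (fun j : ℕ => ∫ x, min (-Real.log x) j ∂gaussMeasure) atTop
      (nhds (π ^ 2 / (12 * Real.log 2))) := by
  have hl := Real.log_pos one_lt_two
  have hnn : 0 ≤ᵐ[gaussMeasure] fun x => -Real.log x := by
    filter_upwards [ae_gaussMeasure_mem] with x hx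
    have h1 := Real.log_nonpos hx.1.le hx.2.le
    simpa using h1
  have hm : Measurable fun x : ℝ => -Real.log x := by fun_prop
  have h_int : Integrable (fun x => -Real.log x) gaussMeasure := by
    rw [← lintegral_ofReal_ne_top_iff_integrable hm.aestronglyMeasurable hnn,
      lintegral_neg_log_gaussMeasure]
    exact ENNReal.ofReal_ne_top
  have hval : ∫ x, -Real.log x ∂gaussMeasure = π ^ 2 / (12 * Real.log 2) := by
    rw [integral_eq_lintegral_of_nonneg_ae hnn hm.aestronglyMeasurable,
      lintegral_neg_log_gaussMeasure, ENNReal.toReal_ofReal (by positivity)]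
  rw [← hval]
  refine tendsto_integral_of_dominated_convergence (fun x => -Real.log x) (fun j => ?_) h_int
    (fun j => ?_) ?_
  · exact (hm.min measurable_const).aestronglyMeasurable
  · filter_upwards [hnn] with x hx
    rw [Real.norm_of_nonneg (le_min hx (Nat.cast_nonneg j))]
    exact min_le_left _ _
  · refine Eventually.of_forall fun x => tendsto_const_nhds.congr' ?_
    filter_upwards [tendsto_natCast_atTop_atTop.eventually_ge_atTop (-Real.log x)] with j hj
    exact (min_eq_left hj).symm

/-- The logarithm of `1 / (x · G x ⋯ G^{n-1} x)`, with `G` the Gauss map. -/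
noncomputable def gaussLogSum (x : ℝ) (n : ℕ) : ℝ :=
  ∑ i ∈ Finset.range n, -Real.log (gaussMap^[i] x)

/-- The sum of the first `k` odd-indexed continued fraction digits. -/
noncomputable def oddDigitSum (x : ℝ) (k : ℕ) : ℕ :=
  ∑ i ∈ Finset.range k, gaussDigit (gaussMap^[2 * i] x)

theorem neg_log_nonneg {x : ℝ} (hx : x ∈ Set.Ioo (0 : ℝ) 1) : 0 ≤ -Real.log x := by
  linarith [Real.log_nonpos hx.1.le hx.2.le]

theorem monotone_gaussLogSum {x : ℝ} (hx : ∀ i, gaussMap^[i] x ∈ Set.Ioo (0 : ℝ) 1) :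
    Monotone (gaussLogSum x) := by
  refine monotone_nat_of_le_succ fun n => ?_
  rw [gaussLogSum, gaussLogSum, Finset.sum_range_succ]
  linarith [neg_log_nonneg (hx n)]

theorem monotone_oddDigitSum (x : ℝ) : Monotone (oddDigitSum x) := by
  refine monotone_nat_of_le_succ fun n => ?_
  rw [oddDigitSum, oddDigitSum, Finset.sum_range_succ]
  exact Nat.le_add_right _ _

theorem ae_tendsto_gaussLogSum_div : ∀ᵐ x ∂gaussMeasure,
    Tendsto (fun n : ℕ => gaussLogSum x n / n) atTop (nhds (π ^ 2 / (12 * Real.log 2))) := by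
  have hE := tendsto_integral_min_neg_log
  obtain ⟨C, hC⟩ := hE.bddAbove_range
  have hE0 (j : ℕ) : 0 ≤ ∫ x, min (-Real.log x) j ∂gaussMeasure := by
    refine integral_nonneg_of_ae ?_
    filter_upwards [ae_gaussMeasure_mem] with x hx
      using le_min (neg_log_nonneg hx) (Nat.cast_nonneg j)
  have h1 := ae_eventually_abs_sum_iterate_sub_lt (g := fun j x => min (-Real.log x) j)
    (N := fun j => j) (I := fun j => Finset.range (j ^ 5)) (t := fun j => (j : ℝ) ^ 4)
    (E := fun j => ∫ x, min (-Real.log x) j ∂gaussMeasure)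
    (fun j => by fun_prop)
    (fun j a ha b hb hab => min_le_min_right _ (neg_le_neg (Real.log_le_log ha.1 hab)))
    (fun j x hx => le_min (neg_log_nonneg hx) (Nat.cast_nonneg j))
    (fun j x hx => min_le_right _ _) (fun _ => rfl)
    (by filter_upwards [eventually_gt_atTop 0] with j hj; positivity) (by
      refine Summable.of_norm_bounded_eventually_nat
        (g := fun j : ℕ => C * (1 / (j : ℝ) ^ 2))
        ((Real.summable_one_div_nat_pow.2 one_lt_two).mul_left C) ?_
      filter_upwards [eventually_gt_atTop 0] with j hj
      have hEj := hE0 j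
      have hCj := hC (Set.mem_range_self j)
      rw [Real.norm_of_nonneg (by positivity), Finset.card_range]
      push_cast
      calc (j : ℝ) ^ 5 * j * (∫ x, min (-Real.log x) j ∂gaussMeasure) / ((j : ℝ) ^ 4) ^ 2
          = (∫ x, min (-Real.log x) j ∂gaussMeasure) * (1 / (j : ℝ) ^ 2) := by field_simp
        _ ≤ _ := by gcongr)
  have h2 := ae_eventually_forall_iterate_gt (s := fun j => Real.exp (-j))
    (I := fun j => Finset.range (j ^ 5)) (fun j => by positivity) (fun j => by simp) (by
      simpa using Real.summable_pow_mul_exp_neg_nat_mul 5 one_pos)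
  filter_upwards [h1, h2, ae_iterate_mem] with x hx1 hx2 hx
  apply tendsto_div_of_monotone_of_exists_subseq_tendsto_div _ _ (monotone_gaussLogSum hx)
  intro a ha
  refine ⟨fun n => n ^ 5, ?_, tendsto_pow_atTop (by norm_num), ?_⟩
  · have h3 : Tendsto (fun n : ℕ => (1 + 1 / (n : ℝ)) ^ 5) atTop (nhds 1) := by
      simpa using (tendsto_one_div_atTop_nhds_zero_nat.const_add (1 : ℝ)).pow 5
    filter_upwards [h3.eventually_le_const ha, eventually_gt_atTop 0] with n hn hn0
    push_cast
    have : ((n : ℝ) + 1) ^ 5 = (1 + 1 / (n : ℝ)) ^ 5 * (n : ℝ) ^ 5 := by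
      rw [← mul_pow]; congr 1; field_simp
    rw [this]
    gcongr
  · have hdiff : Tendsto (fun j : ℕ => gaussLogSum x (j ^ 5) / (j ^ 5 : ℕ) -
        ∫ x, min (-Real.log x) j ∂gaussMeasure) atTop (nhds 0) := by
      refine squeeze_zero_norm' ?_ (tendsto_one_div_atTop_nhds_zero_nat (𝕜 := ℝ))
      filter_upwards [hx1, hx2, eventually_gt_atTop 0] with j hj1 hj2 hj0
      have h3 : gaussLogSum x (j ^ 5) =
          ∑ i ∈ Finset.range (j ^ 5), min (-Real.log (gaussMap^[i] x)) j := by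
        refine Finset.sum_congr rfl fun i hi => (min_eq_left ?_).symm
        have := Real.log_le_log (Real.exp_pos _) (hj2 i hi).le
        rw [Real.log_exp] at this
        linarith
      rw [h3]
      rw [Finset.card_range] at hj1
      push_cast at hj1 ⊢
      have h5 : (0 : ℝ) < (j : ℝ) ^ 5 := by positivity
      rw [Real.norm_eq_abs, div_sub' h5.ne', abs_div, abs_of_pos h5, div_le_div_iff₀ h5 (by positivity)]
      nlinarith [hj1, (by positivity : (0 : ℝ) < j)]
    simpa using hdiff.add hE

theorem oddDigitSum_eq_sum_image (φ : ℕ → ℝ) (k : ℕ) :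
    ∑ i ∈ (Finset.range k).image (2 * ·), φ i = ∑ i ∈ Finset.range k, φ (2 * i) :=
  Finset.sum_image fun a _ b _ h => by simpa using h

theorem card_image_two_mul (k : ℕ) : ((Finset.range k).image (2 * ·)).card = k := by
  rw [Finset.card_image_of_injective _ fun a b h => by simpa using h, Finset.card_range]

theorem ae_eventually_abs_truncated_oddDigitSum_sub_lt {k N : ℕ → ℕ} {t : ℕ → ℝ}
    (ht : ∀ᶠ j in atTop, 0 < t j)
    (hs : Summable fun j => k j * N j * (Real.log (N j + 1) / Real.log 2) / t j ^ 2) :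
    ∀ᵐ x ∂gaussMeasure, ∀ᶠ j in atTop,
      |∑ i ∈ Finset.range (k j), ((min (gaussDigit (gaussMap^[2 * i] x)) (N j) : ℕ) : ℝ) -
        k j * (Real.log (N j + 1) / Real.log 2)| < t j := by
  have := ae_eventually_abs_sum_iterate_sub_lt
    (g := fun j x => ((min (gaussDigit x) (N j) : ℕ) : ℝ)) (N := fun j => N j)
    (I := fun j => (Finset.range (k j)).image (2 * ·)) (t := t)
    (E := fun j => Real.log (N j + 1) / Real.log 2)
    (fun j => measurable_from_nat.comp
      (measurable_gaussDigit.min measurable_const : Measurable fun x => min (gaussDigit x) (N j)))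
    (fun j a ha b hb hab => by
      exact Nat.cast_le.2 (min_le_min_right _ (gaussDigit_antitoneOn ha hb hab)))
    (fun j x hx => by positivity)
    (fun j x hx => by exact_mod_cast min_le_right _ _)
    (fun j => integral_min_gaussDigit (N j)) ht (by simpa only [card_image_two_mul] using hs)
  filter_upwards [this] with x hx
  filter_upwards [hx] with j hj
  rwa [card_image_two_mul, oddDigitSum_eq_sum_image
    (fun i => ((min (gaussDigit (gaussMap^[i] x)) (N j) : ℕ) : ℝ))] at hj

theorem ae_eventually_oddDigitSum_pow_ge (m : ℕ) : ∀ᵐ x ∂gaussMeasure, ∀ᶠ j : ℕ in atTop,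
    (j : ℝ) ^ (m + 3) * (m * Real.log j / Real.log 2 - 1) ≤ oddDigitSum x (j ^ (m + 3)) := by
  have hl := Real.log_pos one_lt_two
  have h1 := ae_eventually_abs_truncated_oddDigitSum_sub_lt (k := fun j => j ^ (m + 3))
    (N := fun j => j ^ m) (t := fun j => (j : ℝ) ^ (m + 3))
    (by filter_upwards [eventually_gt_atTop 0] with j hj; positivity) (by
      refine Summable.of_norm_bounded_eventually_nat
        (g := fun j : ℕ => ((m + 1) / Real.log 2) * (1 / (j : ℝ) ^ 2))
        ((Real.summable_one_div_nat_pow.2 one_lt_two).mul_left _) ?_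
      filter_upwards [eventually_gt_atTop 1] with j hj
      have hj' : (2 : ℝ) ≤ j := by exact_mod_cast hj
      have hlog : Real.log ((j : ℝ) ^ m + 1) ≤ (m + 1) * j := by
        have h2 : (j : ℝ) ^ m + 1 ≤ (j : ℝ) ^ (m + 1) := by
          have : (1 : ℝ) ≤ (j : ℝ) ^ m := one_le_pow₀ (by linarith)
          rw [pow_succ]; nlinarith
        refine (Real.log_le_log (by positivity) h2).trans ?_
        rw [Real.log_pow]
        push_cast
        gcongr
        exact Real.log_le_self (by positivity)
      have hlog0 : 0 ≤ Real.log ((j : ℝ) ^ m + 1) := Real.log_nonneg (by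
        have : (0 : ℝ) ≤ (j : ℝ) ^ m := by positivity
        linarith)
      push_cast
      rw [Real.norm_of_nonneg (by positivity)]
      calc (j : ℝ) ^ (m + 3) * (j : ℝ) ^ m * (Real.log ((j : ℝ) ^ m + 1) / Real.log 2) /
            ((j : ℝ) ^ (m + 3)) ^ 2
          = Real.log ((j : ℝ) ^ m + 1) / (Real.log 2 * (j : ℝ) ^ 3) := by
            field_simp
            ring
        _ ≤ (m + 1) * j / (Real.log 2 * (j : ℝ) ^ 3) := by gcongr
        _ = _ := by field_simp)
  filter_upwards [h1] with x hx
  filter_upwards [hx, eventually_gt_atTop 0] with j hj hj0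
  have h2 : ∑ i ∈ Finset.range (j ^ (m + 3)),
      ((min (gaussDigit (gaussMap^[2 * i] x)) (j ^ m) : ℕ) : ℝ) ≤ oddDigitSum x (j ^ (m + 3)) := by
    rw [oddDigitSum]
    push_cast
    gcongr
    exact min_le_left _ _
  have h3 : m * Real.log j ≤ Real.log ((j : ℝ) ^ m + 1) := by
    rw [← Real.log_pow]
    apply Real.log_le_log (by positivity)
    linarith
  have h4 := (abs_lt.1 hj).1
  have h5 : (j : ℝ) ^ (m + 3) * (m * Real.log j / Real.log 2) ≤
      (j : ℝ) ^ (m + 3) * (Real.log ((j : ℝ) ^ m + 1) / Real.log 2) := by gcongr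
  push_cast at h4 h2
  linarith

theorem ae_eventually_oddDigitSum_ge : ∀ᵐ x ∂gaussMeasure, ∀ δ : ℝ, δ < 1 →
    ∀ᶠ k : ℕ in atTop, δ * (k * Real.log k / Real.log 2) ≤ oddDigitSum x k := by
  have hl := Real.log_pos one_lt_two
  filter_upwards [ae_all_iff.2 ae_eventually_oddDigitSum_pow_ge] with x hx δ hδ
  wlog hδ0 : 0 < δ generalizing δ
  · filter_upwards [this (1 / 2) (by norm_num) (by norm_num)] with k hk
    refine le_trans ?_ hk
    have : 0 ≤ (k : ℝ) * Real.log k / Real.log 2 := by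
      have := Real.log_natCast_nonneg k
      positivity
    gcongr
    linarith
  obtain ⟨m, hm⟩ : ∃ m : ℕ, δ < m / (m + 3) := by
    have h : Tendsto (fun m : ℕ => (m : ℝ) / (m + 3)) atTop (nhds 1) :=
      tendsto_natCast_div_add_atTop 3
    exact (h.eventually_const_lt hδ).exists
  have hlim : Tendsto (fun j : ℕ => (1 - 1 / ((j : ℝ) + 1)) ^ (m + 3) *
      ((m * (Real.log j / Real.log (j + 1)) - Real.log 2 / Real.log (j + 1)) / (m + 3))) atTop
      (nhds ((1 - 0) ^ (m + 3) * ((m * 1 - 0) / (m + 3)))) := by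
    have hlog : Tendsto (fun j : ℕ => Real.log ((j : ℝ) + 1)) atTop atTop :=
      Real.tendsto_log_atTop.comp (tendsto_atTop_add_const_right _ _ tendsto_natCast_atTop_atTop)
    have h2 : Tendsto (fun j : ℕ => Real.log 2 / Real.log ((j : ℝ) + 1)) atTop (nhds 0) :=
      hlog.const_div_atTop _
    have h1 : Tendsto (fun j : ℕ => Real.log j / Real.log ((j : ℝ) + 1)) atTop (nhds 1) := by
      have h3 : Tendsto (fun j : ℕ => 1 - Real.log 2 / Real.log ((j : ℝ) + 1)) atTop (nhds 1) := by
        simpa using h2.const_sub 1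
      refine tendsto_of_tendsto_of_tendsto_of_le_of_le' h3 tendsto_const_nhds ?_ ?_
      · filter_upwards [eventually_gt_atTop 0] with j hj
        have hj' : (1 : ℝ) ≤ j := by exact_mod_cast hj
        have hp : 0 < Real.log ((j : ℝ) + 1) := Real.log_pos (by linarith)
        rw [one_sub_div hp.ne']
        gcongr
        have : Real.log ((j : ℝ) + 1) ≤ Real.log (2 * j) :=
          Real.log_le_log (by linarith) (by linarith)
        rw [Real.log_mul (by norm_num) (by positivity)] at this
        linarith
      · filter_upwards [eventually_gt_atTop 0] with j hj
        have hj' : (1 : ℝ) ≤ j := by exact_mod_cast hj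
        have hp : 0 < Real.log ((j : ℝ) + 1) := Real.log_pos (by linarith)
        rw [div_le_one hp]
        exact Real.log_le_log (by linarith) (by linarith)
    exact ((tendsto_one_div_add_atTop_nhds_zero_nat.const_sub 1).pow _).mul
      (((h1.const_mul _).sub h2).div_const _)
  have hev := hlim.eventually_const_lt (u := δ) (by simpa using hm)
  obtain ⟨J, hJ⟩ := eventually_atTop.1 ((hx m).and hev)
  filter_upwards [eventually_ge_atTop ((J + 1) ^ (m + 3))] with k hk
  obtain ⟨j, hj1, hj2⟩ : ∃ j, j ^ (m + 3) ≤ k ∧ k < (j + 1) ^ (m + 3) := by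
    have hex : ∃ j, k < (j + 1) ^ (m + 3) :=
      ⟨k, (Nat.lt_succ_self k).trans_le (Nat.le_self_pow (by omega) _)⟩
    classical
    refine ⟨Nat.find hex, ?_, Nat.find_spec hex⟩
    rcases Nat.eq_zero_or_pos (Nat.find hex) with h | h
    · rw [h]; simp
    · have := Nat.find_min hex (Nat.sub_lt h one_pos)
      rw [Nat.sub_add_cancel (show 1 ≤ Nat.find hex from h)] at this
      omega
  have hJj : J + 1 ≤ j := by
    by_contra hlt
    have : (j + 1) ^ (m + 3) ≤ (J + 1) ^ (m + 3) := Nat.pow_le_pow_left (by omega) _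
    omega
  obtain ⟨hA, hB⟩ := hJ j (by omega)
  have hj0 : (1 : ℝ) ≤ j := by exact_mod_cast (show 1 ≤ j by omega)
  have hk0 : (1 : ℝ) ≤ k := by
    exact_mod_cast (Nat.one_le_pow _ _ (by omega : 0 < j)).trans hj1
  have hp : 0 < Real.log ((j : ℝ) + 1) := Real.log_pos (by linarith)
  have hmono : (oddDigitSum x (j ^ (m + 3)) : ℝ) ≤ oddDigitSum x k := by
    exact_mod_cast monotone_oddDigitSum x hj1
  have hk2 : (k : ℝ) ≤ ((j : ℝ) + 1) ^ (m + 3) := by exact_mod_cast hj2.le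
  have hlogk : Real.log k ≤ (m + 3) * Real.log ((j : ℝ) + 1) := by
    have := Real.log_le_log (by linarith) hk2
    rw [Real.log_pow] at this
    push_cast at this
    exact this
  have hlogk0 : 0 ≤ Real.log k := Real.log_natCast_nonneg k
  calc δ * (k * Real.log k / Real.log 2)
      ≤ δ * (((j : ℝ) + 1) ^ (m + 3) * ((m + 3) * Real.log ((j : ℝ) + 1)) / Real.log 2) := by
        gcongr
    _ ≤ ((1 - 1 / ((j : ℝ) + 1)) ^ (m + 3) *
          ((m * (Real.log j / Real.log (j + 1)) - Real.log 2 / Real.log (j + 1)) / (m + 3))) *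
          (((j : ℝ) + 1) ^ (m + 3) * ((m + 3) * Real.log ((j : ℝ) + 1)) / Real.log 2) := by
        gcongr
    _ = (j : ℝ) ^ (m + 3) * (m * Real.log j / Real.log 2 - 1) := by
        have h1 : (1 - 1 / ((j : ℝ) + 1)) = j / (j + 1) := by field_simp; ring
        rw [h1, div_pow]
        field_simp
    _ ≤ _ := hA.trans hmono

theorem ae_frequently_oddDigitSum_le : ∀ᵐ x ∂gaussMeasure, ∀ δ : ℝ, 1 < δ →
    ∃ᶠ k : ℕ in atTop, (oddDigitSum x k : ℝ) ≤ δ * (k * Real.log k / Real.log 2) := by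
  have hl := Real.log_pos one_lt_two
  have hlogN (j : ℕ) (hj : 0 < j) :
      Real.log (((2 ^ j ^ 6 * j ^ 2 : ℕ) : ℝ) + 1) / Real.log 2 ≤ (j : ℝ) ^ 6 + 3 * j := by
    rw [div_le_iff₀ hl]
    have h1 : ((2 ^ j ^ 6 * j ^ 2 : ℕ) : ℝ) + 1 ≤ 2 ^ (j ^ 6 + 2 * j + 1) := by
      have h2 : 2 ^ j ^ 6 * j ^ 2 + 1 ≤ 2 ^ (j ^ 6 + 2 * j + 1) := by
        have h3 : j ^ 2 ≤ 2 ^ (2 * j) := by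
          rw [mul_comm 2 j, pow_mul]; exact Nat.pow_le_pow_left Nat.lt_two_pow_self.le 2
        have h4 : 0 < 2 ^ j ^ 6 * 2 ^ (2 * j) := by positivity
        have h5 := Nat.mul_le_mul_left (2 ^ j ^ 6) h3
        rw [show 2 ^ (j ^ 6 + 2 * j + 1) = 2 ^ j ^ 6 * 2 ^ (2 * j) * 2 by
          rw [pow_succ 2 (j ^ 6 + 2 * j), pow_add 2 (j ^ 6)]]
        linarith
      exact_mod_cast h2
    refine (Real.log_le_log (by positivity) h1).trans ?_
    rw [Real.log_pow]
    gcongr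
    push_cast
    have : (1 : ℝ) ≤ j := by exact_mod_cast hj
    linarith
  have h1 := ae_eventually_abs_truncated_oddDigitSum_sub_lt (k := fun j => 2 ^ j ^ 6)
    (N := fun j => 2 ^ j ^ 6 * j ^ 2) (t := fun j => ((2 ^ j ^ 6 : ℕ) : ℝ) * (j : ℝ) ^ 5)
    (by filter_upwards [eventually_gt_atTop 0] with j hj; positivity) (by
      refine Summable.of_norm_bounded_eventually_nat
        (g := fun j : ℕ => 4 * (1 / (j : ℝ) ^ 2))
        ((Real.summable_one_div_nat_pow.2 one_lt_two).mul_left _) ?_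
      filter_upwards [eventually_gt_atTop 0] with j hj
      have hj' : (1 : ℝ) ≤ j := by exact_mod_cast hj
      have h2 := hlogN j hj
      have h3 : (j : ℝ) ≤ (j : ℝ) ^ 6 := le_self_pow₀ hj' (by norm_num)
      have h4 : 0 ≤ Real.log (((2 ^ j ^ 6 * j ^ 2 : ℕ) : ℝ) + 1) / Real.log 2 := by
        have : 0 ≤ Real.log (((2 ^ j ^ 6 * j ^ 2 : ℕ) : ℝ) + 1) := Real.log_nonneg (by
          linarith [(Nat.cast_nonneg (2 ^ j ^ 6 * j ^ 2) : (0 : ℝ) ≤ (2 ^ j ^ 6 * j ^ 2 : ℕ))])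
        positivity
      rw [Real.norm_of_nonneg (by positivity)]
      set L := Real.log (((2 ^ j ^ 6 * j ^ 2 : ℕ) : ℝ) + 1) / Real.log 2
      calc ((2 ^ j ^ 6 : ℕ) : ℝ) * ((2 ^ j ^ 6 * j ^ 2 : ℕ) : ℝ) * L /
            (((2 ^ j ^ 6 : ℕ) : ℝ) * (j : ℝ) ^ 5) ^ 2
          = L / (j : ℝ) ^ 8 := by push_cast; field_simp
        _ ≤ 4 * (j : ℝ) ^ 6 / (j : ℝ) ^ 8 := by gcongr; linarith
        _ = _ := by field_simp)
  have h2 := ae_eventually_forall_iterate_gt (s := fun j => 1 / (((2 ^ j ^ 6 * j ^ 2 : ℕ) : ℝ) + 1))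
    (I := fun j => (Finset.range (2 ^ j ^ 6)).image (2 * ·)) (fun j => by positivity)
    (fun j => by
      rw [div_le_one (by positivity)]
      linarith [(Nat.cast_nonneg (2 ^ j ^ 6 * j ^ 2) : (0 : ℝ) ≤ (2 ^ j ^ 6 * j ^ 2 : ℕ))]) (by
      refine Summable.of_norm_bounded_eventually_nat (g := fun j : ℕ => 1 / (j : ℝ) ^ 2)
        (Real.summable_one_div_nat_pow.2 one_lt_two) ?_
      filter_upwards [eventually_gt_atTop 0] with j hj
      rw [card_image_two_mul, Real.norm_of_nonneg (by positivity), mul_one_div,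
        div_le_div_iff₀ (by positivity) (by positivity)]
      push_cast
      linarith)
  filter_upwards [h1, h2, ae_iterate_mem] with x hx1 hx2 hx δ hδ
  have htend : Tendsto (fun j : ℕ => 2 ^ j ^ 6) atTop atTop :=
    (tendsto_pow_atTop_atTop_of_one_lt one_lt_two).comp (tendsto_pow_atTop (by norm_num))
  refine htend.frequently (Eventually.frequently ?_)
  filter_upwards [hx1, hx2, eventually_gt_atTop 0,
    tendsto_natCast_atTop_atTop.eventually_ge_atTop (4 / (δ - 1))] with j hj1 hj2 hj0 hj3
  have hj' : (1 : ℝ) ≤ j := by exact_mod_cast hj0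
  have hS : (oddDigitSum x (2 ^ j ^ 6) : ℝ) = ∑ i ∈ Finset.range (2 ^ j ^ 6),
      ((min (gaussDigit (gaussMap^[2 * i] x)) (2 ^ j ^ 6 * j ^ 2) : ℕ) : ℝ) := by
    rw [oddDigitSum, Nat.cast_sum]
    refine Finset.sum_congr rfl fun i hi => ?_
    rw [min_eq_left]
    have := hj2 (2 * i) (Finset.mem_image_of_mem _ hi)
    by_contra hlt
    rw [not_le, lt_gaussDigit_iff (hx _).1] at hlt
    linarith
  have hub := (abs_lt.1 hj1).2
  rw [← hS] at hub
  have h3 := hlogN j hj0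
  have h4 : (j : ℝ) ≤ (j : ℝ) ^ 5 := le_self_pow₀ hj' (by norm_num)
  have h5 : 4 ≤ (δ - 1) * j := by
    rw [div_le_iff₀ (by linarith)] at hj3; linarith
  have h6 : 4 * (j : ℝ) ^ 5 ≤ (δ - 1) * (j : ℝ) ^ 6 := by
    calc 4 * (j : ℝ) ^ 5 ≤ ((δ - 1) * j) * (j : ℝ) ^ 5 := by gcongr
      _ = _ := by ring
  have hlogk : Real.log ((2 ^ j ^ 6 : ℕ) : ℝ) / Real.log 2 = (j : ℝ) ^ 6 := by
    push_cast
    rw [Real.log_pow]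
    push_cast
    field_simp
  rw [mul_div_assoc, hlogk]
  have hkpos : (0 : ℝ) < ((2 ^ j ^ 6 : ℕ) : ℝ) := by positivity
  set K : ℝ := ((2 ^ j ^ 6 : ℕ) : ℝ)
  have h7 : K * (Real.log (((2 ^ j ^ 6 * j ^ 2 : ℕ) : ℝ) + 1) / Real.log 2) ≤
      K * ((j : ℝ) ^ 6 + 3 * j) := by gcongr
  have h8 : K * ((j : ℝ) ^ 6 + 3 * j + (j : ℝ) ^ 5) ≤ K * (δ * (j : ℝ) ^ 6) := by
    gcongr; linarith
  linarith

theorem one_sub_gaussDigit_mul {x : ℝ} (hx : x ∈ Set.Ioo (0 : ℝ) 1) :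
    1 - gaussDigit x * x = x * gaussMap x := by
  have h : gaussMap x = x⁻¹ - gaussDigit x := by
    rw [gaussMap, gaussDigit, Int.fract, natCast_floor_eq_intCast_floor (inv_nonneg.2 hx.1.le)]
  rw [h, mul_sub, mul_inv_cancel₀ hx.1.ne']
  ring

theorem natCast_mul_lt_one_of_le_gaussDigit {x : ℝ} (hx : x ∈ Set.Ioo (0 : ℝ) 1)
    (h1 : gaussMap x ∈ Set.Ioo (0 : ℝ) 1) {j : ℕ} (hj : j ≤ gaussDigit x) : j * x < 1 := by
  have h2 : (j : ℝ) * x ≤ gaussDigit x * x := by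
    have := hx.1
    gcongr
  linarith [one_sub_gaussDigit_mul hx, mul_pos hx.1 h1.1]

theorem one_le_gaussDigit {x : ℝ} (hx : x ∈ Set.Ioo (0 : ℝ) 1) : 1 ≤ gaussDigit x :=
  Nat.le_floor (by simpa using (one_le_inv₀ hx.1).2 hx.2.le)

theorem negT_iterate_of_lt_gaussDigit {x : ℝ} (hx : x ∈ Set.Ioo (0 : ℝ) 1)
    (h1 : gaussMap x ∈ Set.Ioo (0 : ℝ) 1) {j : ℕ} (hj : j < gaussDigit x) :
    negT^[j] (1 - x) = (1 - ((j + 1 : ℕ) : ℝ) * x) / (1 - j * x) := by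
  induction j with
  | zero => simp
  | succ j ih =>
    have h2 := natCast_mul_lt_one_of_le_gaussDigit hx h1 (show j + 1 + 1 ≤ gaussDigit x from hj)
    have h3 := natCast_mul_lt_one_of_le_gaussDigit hx h1 (show j + 1 ≤ gaussDigit x by omega)
    have h4 := natCast_mul_lt_one_of_le_gaussDigit hx h1 (show j ≤ gaussDigit x by omega)
    have hx0 := hx.1
    rw [Function.iterate_succ_apply', ih (by omega), negT, Int.fract_eq_iff]
    push_cast at h2 h3 ⊢
    have h5 : 0 < 1 - ((j : ℝ) + 1) * x := by linarith
    have h6 : 0 < 1 - (j : ℝ) * x := by linarith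
    refine ⟨div_nonneg (by linarith) h5.le, (div_lt_one h5).2 (by linarith), -2, ?_⟩
    push_cast
    field_simp
    ring

theorem negT_iterate_gaussDigit {x : ℝ} (hx : x ∈ Set.Ioo (0 : ℝ) 1)
    (h1 : gaussMap x ∈ Set.Ioo (0 : ℝ) 1) (h2 : gaussMap (gaussMap x) ∈ Set.Ioo (0 : ℝ) 1) :
    negT^[gaussDigit x] (1 - x) = 1 - gaussMap (gaussMap x) := by
  obtain ⟨j, hj⟩ := Nat.exists_eq_add_of_le' (one_le_gaussDigit hx)
  have h4 := natCast_mul_lt_one_of_le_gaussDigit hx h1 (show j ≤ gaussDigit x by omega)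
  have h5 := one_sub_gaussDigit_mul hx
  have hx0 := hx.1
  have h10 := h1.1
  rw [hj, Function.iterate_succ_apply', negT_iterate_of_lt_gaussDigit hx h1 (by omega), ← hj, h5,
    negT]
  have h6 : (j : ℝ) = gaussDigit x - 1 := by rw [hj]; simp
  have h7 : -1 / (x * gaussMap x / (1 - j * x)) = -(gaussMap x)⁻¹ - 1 := by
    have : 1 - (j : ℝ) * x = x * gaussMap x + x := by rw [h6]; linarith
    rw [this]
    field_simp
    ring
  have h8 : Int.fract (gaussMap x)⁻¹ ≠ 0 := h2.1.ne'
  rw [h7, Int.fract_sub_one, Int.fract_neg h8]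
  rfl

theorem sum_log_negT_iterate_block {x : ℝ} (hx : x ∈ Set.Ioo (0 : ℝ) 1)
    (h1 : gaussMap x ∈ Set.Ioo (0 : ℝ) 1) :
    ∑ j ∈ Finset.range (gaussDigit x), Real.log (negT^[j] (1 - x)) =
      Real.log x + Real.log (gaussMap x) := by
  have h : ∀ j ∈ Finset.range (gaussDigit x), Real.log (negT^[j] (1 - x)) =
      Real.log (1 - ((j + 1 : ℕ) : ℝ) * x) - Real.log (1 - (j : ℝ) * x) := fun j hj => by
    have hj := Finset.mem_range.1 hj
    rw [negT_iterate_of_lt_gaussDigit hx h1 hj, Real.log_div]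
    · linarith [natCast_mul_lt_one_of_le_gaussDigit hx h1 (Nat.succ_le_of_lt hj)]
    · linarith [natCast_mul_lt_one_of_le_gaussDigit hx h1 hj.le]
  rw [Finset.sum_congr rfl h, Finset.sum_range_sub (fun j : ℕ => Real.log (1 - (j : ℝ) * x)),
    one_sub_gaussDigit_mul hx, Real.log_mul hx.1.ne' h1.1.ne']
  simp

theorem oddDigitSum_succ (x : ℝ) (k : ℕ) :
    oddDigitSum x (k + 1) = gaussDigit (gaussMap^[2 * k] x) + oddDigitSum x k := by
  rw [oddDigitSum, Finset.sum_range_succ, add_comm]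
  rfl

theorem negT_iterate_oddDigitSum {x : ℝ} (hx : ∀ i, gaussMap^[i] x ∈ Set.Ioo (0 : ℝ) 1) (k : ℕ) :
    negT^[oddDigitSum x k] (1 - x) = 1 - gaussMap^[2 * k] x := by
  induction k with
  | zero => simp [oddDigitSum]
  | succ k ih =>
    have h1 := hx (2 * k + 1)
    have h2 := hx (2 * k + 2)
    rw [Function.iterate_succ_apply'] at h1
    rw [Function.iterate_succ_apply', Function.iterate_succ_apply'] at h2
    rw [oddDigitSum_succ, Function.iterate_add_apply, ih, negT_iterate_gaussDigit (hx _) h1 h2,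
      show 2 * (k + 1) = 2 * k + 1 + 1 by ring, Function.iterate_succ_apply',
      Function.iterate_succ_apply']

theorem strictMono_oddDigitSum {x : ℝ} (hx : ∀ i, gaussMap^[i] x ∈ Set.Ioo (0 : ℝ) 1) :
    StrictMono (oddDigitSum x) :=
  strictMono_nat_of_lt_succ fun k => by
    have := one_le_gaussDigit (hx (2 * k))
    rw [oddDigitSum_succ]
    omega

theorem exists_oddDigitSum_le_lt {x : ℝ} (hx : ∀ i, gaussMap^[i] x ∈ Set.Ioo (0 : ℝ) 1) (n : ℕ) :
    ∃ k, oddDigitSum x k ≤ n ∧ n < oddDigitSum x (k + 1) := by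
  induction n with
  | zero =>
    refine ⟨0, by simp [oddDigitSum], ?_⟩
    exact (Nat.zero_le _).trans_lt (strictMono_oddDigitSum hx zero_lt_one)
  | succ n ih =>
    obtain ⟨k, h1, h2⟩ := ih
    by_cases h : n + 1 < oddDigitSum x (k + 1)
    · exact ⟨k, by omega, h⟩
    · exact ⟨k + 1, by omega,
        (Nat.succ_le_of_lt h2).trans_lt (strictMono_oddDigitSum hx (Nat.lt_succ_self _))⟩

theorem negT_iterate_mem {x : ℝ} (hx : ∀ i, gaussMap^[i] x ∈ Set.Ioo (0 : ℝ) 1) (n : ℕ) :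
    negT^[n] (1 - x) ∈ Set.Ioo (0 : ℝ) 1 := by
  obtain ⟨k, h1, h2⟩ := exists_oddDigitSum_le_lt hx n
  obtain ⟨j, rfl⟩ := Nat.exists_eq_add_of_le' h1
  have hj : j < gaussDigit (gaussMap^[2 * k] x) := by rw [oddDigitSum_succ] at h2; omega
  have h3 := hx (2 * k + 1)
  rw [Function.iterate_succ_apply'] at h3
  rw [Function.iterate_add_apply, negT_iterate_oddDigitSum hx,
    negT_iterate_of_lt_gaussDigit (hx _) h3 hj]
  have h4 := natCast_mul_lt_one_of_le_gaussDigit (hx _) h3 (Nat.succ_le_of_lt hj)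
  have h5 := natCast_mul_lt_one_of_le_gaussDigit (hx _) h3 hj.le
  have h6 := (hx (2 * k)).1
  refine ⟨div_pos (by linarith) (by linarith), (div_lt_one (by linarith)).2 ?_⟩
  push_cast
  linarith

theorem sum_log_negT_iterate {x : ℝ} (hx : ∀ i, gaussMap^[i] x ∈ Set.Ioo (0 : ℝ) 1) (k : ℕ) :
    ∑ i ∈ Finset.range (oddDigitSum x k), Real.log (negT^[i] (1 - x)) =
      -gaussLogSum x (2 * k) := by
  induction k with
  | zero => simp [oddDigitSum, gaussLogSum]
  | succ k ih =>
    have h3 := hx (2 * k + 1)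
    rw [Function.iterate_succ_apply'] at h3
    have h4 : ∀ j, negT^[oddDigitSum x k + j] (1 - x) = negT^[j] (1 - gaussMap^[2 * k] x) :=
      fun j => by rw [add_comm, Function.iterate_add_apply, negT_iterate_oddDigitSum hx]
    rw [oddDigitSum_succ, add_comm, Finset.sum_range_add, ih]
    simp_rw [h4]
    rw [sum_log_negT_iterate_block (hx _) h3, gaussLogSum, gaussLogSum,
      show 2 * (k + 1) = 2 * k + 1 + 1 by ring, Finset.sum_range_succ _ (2 * k + 1),
      Finset.sum_range_succ _ (2 * k), Function.iterate_succ_apply']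
    ring

/-- The denominators `Q_n - y_n Q_{n-1}`, with `y_n` the `n`-th tail. -/
noncomputable def negTailDenom (x : ℝ) (n : ℕ) : ℝ :=
  negQ x (n + 1) - negT^[n] (1 - x) * negQ x n

theorem negDigit_succ {x : ℝ} (hx : ∀ i, gaussMap^[i] x ∈ Set.Ioo (0 : ℝ) 1) (n : ℕ) :
    (negDigit x (n + 1) : ℝ) = 1 / negT^[n] (1 - x) + negT^[n + 1] (1 - x) := by
  have h := negT_iterate_mem hx n
  rw [negDigit, Nat.add_sub_cancel, Function.iterate_succ_apply']
  set y := negT^[n] (1 - x)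
  have h0 : 0 ≤ ⌈1 / y⌉ := Int.ceil_nonneg (one_div_nonneg.2 h.1.le)
  have h1 : ((⌈1 / y⌉.toNat : ℕ) : ℝ) = ((⌈1 / y⌉ : ℤ) : ℝ) := by
    rw [← Int.cast_natCast, Int.toNat_of_nonneg h0]
  rw [h1, negT, Int.fract, neg_div, Int.floor_neg]
  push_cast
  ring

theorem two_le_negDigit_succ {x : ℝ} (hx : ∀ i, gaussMap^[i] x ∈ Set.Ioo (0 : ℝ) 1) (n : ℕ) :
    2 ≤ negDigit x (n + 1) := by
  have h := negT_iterate_mem hx n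
  have h1 : (1 : ℝ) < negDigit x (n + 1) := by
    rw [negDigit_succ hx]
    linarith [(negT_iterate_mem hx (n + 1)).1, (one_lt_one_div h.1 h.2)]
  exact_mod_cast h1

theorem negTailDenom_succ {x : ℝ} (hx : ∀ i, gaussMap^[i] x ∈ Set.Ioo (0 : ℝ) 1) (n : ℕ) :
    negTailDenom x (n + 1) = negTailDenom x n / negT^[n] (1 - x) := by
  have h := (negT_iterate_mem hx n).1
  rw [negTailDenom, negTailDenom, negQ]
  push_cast
  rw [negDigit_succ hx]
  field_simp
  ring

theorem negTailDenom_pos {x : ℝ} (hx : ∀ i, gaussMap^[i] x ∈ Set.Ioo (0 : ℝ) 1) (n : ℕ) :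
    0 < negTailDenom x n := by
  induction n with
  | zero => simp [negTailDenom, negQ]
  | succ n ih =>
    rw [negTailDenom_succ hx]
    exact div_pos ih (negT_iterate_mem hx n).1

theorem monotone_negTailDenom {x : ℝ} (hx : ∀ i, gaussMap^[i] x ∈ Set.Ioo (0 : ℝ) 1) :
    Monotone (negTailDenom x) := by
  refine monotone_nat_of_le_succ fun n => ?_
  rw [negTailDenom_succ hx]
  have h := negT_iterate_mem hx n
  exact le_div_self (negTailDenom_pos hx n).le h.1 h.2.le

theorem log_negTailDenom {x : ℝ} (hx : ∀ i, gaussMap^[i] x ∈ Set.Ioo (0 : ℝ) 1) (n : ℕ) :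
    Real.log (negTailDenom x n) = -∑ i ∈ Finset.range n, Real.log (negT^[i] (1 - x)) := by
  induction n with
  | zero => simp [negTailDenom, negQ]
  | succ n ih =>
    rw [negTailDenom_succ hx, Real.log_div (negTailDenom_pos hx n).ne' (negT_iterate_mem hx n).1.ne',
      ih, Finset.sum_range_succ]
    ring

theorem log_negTailDenom_oddDigitSum {x : ℝ} (hx : ∀ i, gaussMap^[i] x ∈ Set.Ioo (0 : ℝ) 1)
    (k : ℕ) : Real.log (negTailDenom x (oddDigitSum x k)) = gaussLogSum x (2 * k) := by
  rw [log_negTailDenom hx, sum_log_negT_iterate hx, neg_neg]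

theorem negQ_nonneg_and_le_succ {x : ℝ} (hx : ∀ i, gaussMap^[i] x ∈ Set.Ioo (0 : ℝ) 1) (n : ℕ) :
    0 ≤ negQ x n ∧ negQ x n ≤ negQ x (n + 1) := by
  induction n with
  | zero => simp [negQ]
  | succ n ih =>
    refine ⟨ih.1.trans ih.2, ?_⟩
    have h : (2 : ℤ) ≤ negDigit x (n + 1) := by exact_mod_cast two_le_negDigit_succ hx n
    rw [negQ]
    nlinarith [ih.1, ih.2]

theorem monotone_negQ {x : ℝ} (hx : ∀ i, gaussMap^[i] x ∈ Set.Ioo (0 : ℝ) 1) :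
    Monotone (negQ x) :=
  monotone_nat_of_le_succ fun n => (negQ_nonneg_and_le_succ hx n).2

theorem negTailDenom_le_negQ {x : ℝ} (hx : ∀ i, gaussMap^[i] x ∈ Set.Ioo (0 : ℝ) 1) (n : ℕ) :
    negTailDenom x n ≤ negQ x (n + 1) := by
  have h : (0 : ℝ) ≤ negQ x n := by exact_mod_cast (negQ_nonneg_and_le_succ hx n).1
  rw [negTailDenom]
  linarith [mul_nonneg (negT_iterate_mem hx n).1.le h]

theorem one_sub_mul_negQ_le {x : ℝ} (hx : ∀ i, gaussMap^[i] x ∈ Set.Ioo (0 : ℝ) 1) (n : ℕ) :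
    (1 - negT^[n] (1 - x)) * negQ x (n + 1) ≤ negTailDenom x n := by
  have h : (negQ x n : ℝ) ≤ negQ x (n + 1) := by exact_mod_cast (negQ_nonneg_and_le_succ hx n).2
  rw [negTailDenom]
  linarith [mul_le_mul_of_nonneg_left h (negT_iterate_mem hx n).1.le]

theorem negP_mul_negQ_sub (x : ℝ) (n : ℕ) :
    negP x (n + 1) * negQ x n - negP x n * negQ x (n + 1) = -1 := by
  induction n with
  | zero => simp [negP, negQ]
  | succ n ih =>
    rw [negP, negQ]
    linarith

theorem mul_negTailDenom {x : ℝ} (hx : ∀ i, gaussMap^[i] x ∈ Set.Ioo (0 : ℝ) 1) (n : ℕ) :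
    x * negTailDenom x n = negP x (n + 1) - negT^[n] (1 - x) * negP x n := by
  induction n with
  | zero => simp [negTailDenom, negQ, negP]
  | succ n ih =>
    have h := (negT_iterate_mem hx n).1
    rw [negTailDenom_succ hx, ← mul_div_assoc, ih, negP]
    push_cast
    rw [negDigit_succ hx]
    field_simp
    ring

theorem abs_sub_negP_div_negQ {x : ℝ} (hx : ∀ i, gaussMap^[i] x ∈ Set.Ioo (0 : ℝ) 1) (n : ℕ) :
    |x - negP x (n + 1) / negQ x (n + 1)| =
      1 / (negQ x (n + 1) * negTailDenom x (n + 1)) := by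
  have hD := negTailDenom_pos hx n
  have hy := (negT_iterate_mem hx n).1
  have hQ : (0 : ℝ) < negQ x (n + 1) := hD.trans_le (negTailDenom_le_negQ hx n)
  have h1 : (negP x (n + 1) * negQ x n - negP x n * negQ x (n + 1) : ℝ) = -1 := by
    exact_mod_cast negP_mul_negQ_sub x n
  have h2 : x - negP x (n + 1) / negQ x (n + 1) =
      -(negT^[n] (1 - x) / (negTailDenom x n * negQ x (n + 1))) := by
    rw [← sub_eq_zero, ← mul_left_inj' (mul_pos hD hQ).ne']
    field_simp
    have h3 := mul_negTailDenom hx n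
    rw [negTailDenom] at h3 ⊢
    linear_combination (negQ x (n + 1) : ℝ) * h3 + negT^[n] (1 - x) * h1
  rw [h2, abs_neg, abs_of_pos (by positivity), negTailDenom_succ hx]
  field_simp

theorem log_negTailDenom_nonneg {x : ℝ} (hx : ∀ i, gaussMap^[i] x ∈ Set.Ioo (0 : ℝ) 1) (n : ℕ) :
    0 ≤ Real.log (negTailDenom x n) :=
  Real.log_nonneg ((by simp [negTailDenom, negQ] : (1 : ℝ) ≤ negTailDenom x 0).trans
    (monotone_negTailDenom hx n.zero_le))

theorem log_negQ_le {x : ℝ} (hx : ∀ i, gaussMap^[i] x ∈ Set.Ioo (0 : ℝ) 1) {k n : ℕ}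
    (hn : n ≤ oddDigitSum x k) : Real.log (negQ x (n + 1)) ≤ gaussLogSum x (2 * k + 1) := by
  have hQ (m : ℕ) : (0 : ℝ) < negQ x (m + 1) :=
    (negTailDenom_pos hx m).trans_le (negTailDenom_le_negQ hx m)
  have h1 : (negQ x (n + 1) : ℝ) ≤ negQ x (oddDigitSum x k + 1) := by
    exact_mod_cast monotone_negQ hx (Nat.succ_le_succ hn)
  have h2 := one_sub_mul_negQ_le hx (oddDigitSum x k)
  rw [negT_iterate_oddDigitSum hx, sub_sub_cancel] at h2
  have h3 := Real.log_le_log (mul_pos (hx (2 * k)).1 (hQ _)) h2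
  rw [Real.log_mul (hx (2 * k)).1.ne' (hQ _).ne', log_negTailDenom_oddDigitSum hx] at h3
  rw [gaussLogSum, Finset.sum_range_succ, ← gaussLogSum]
  linarith [Real.log_le_log (hQ n) h1]

theorem gaussLogSum_le_log_negTailDenom {x : ℝ}
    (hx : ∀ i, gaussMap^[i] x ∈ Set.Ioo (0 : ℝ) 1) {k n : ℕ} (hn : oddDigitSum x k ≤ n) :
    gaussLogSum x (2 * k) ≤ Real.log (negTailDenom x n) := by
  rw [← log_negTailDenom_oddDigitSum hx]
  exact Real.log_le_log (negTailDenom_pos hx _) (monotone_negTailDenom hx hn)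

theorem gaussLogSum_le_log_negQ {x : ℝ}
    (hx : ∀ i, gaussMap^[i] x ∈ Set.Ioo (0 : ℝ) 1) {k n : ℕ} (hn : oddDigitSum x k ≤ n) :
    gaussLogSum x (2 * k) ≤ Real.log (negQ x (n + 1)) :=
  (gaussLogSum_le_log_negTailDenom hx hn).trans
    (Real.log_le_log (negTailDenom_pos hx _) (negTailDenom_le_negQ hx n))

theorem log_abs_sub_negP_div_negQ {x : ℝ} (hx : ∀ i, gaussMap^[i] x ∈ Set.Ioo (0 : ℝ) 1) (n : ℕ) :
    Real.log |x - negP x (n + 1) / negQ x (n + 1)| =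
      -(Real.log (negQ x (n + 1)) + Real.log (negTailDenom x (n + 1))) := by
  have hQ : (0 : ℝ) < negQ x (n + 1) :=
    (negTailDenom_pos hx n).trans_le (negTailDenom_le_negQ hx n)
  rw [abs_sub_negP_div_negQ hx, one_div, Real.log_inv,
    Real.log_mul hQ.ne' (negTailDenom_pos hx _).ne']

theorem log_negTailDenom_le {x : ℝ}
    (hx : ∀ i, gaussMap^[i] x ∈ Set.Ioo (0 : ℝ) 1) {k n : ℕ} (hn : n ≤ oddDigitSum x k) :
    Real.log (negTailDenom x n) ≤ gaussLogSum x (2 * k + 1) := by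
  refine (Real.log_le_log (negTailDenom_pos hx _) (monotone_negTailDenom hx hn)).trans ?_
  rw [log_negTailDenom_oddDigitSum hx]
  exact monotone_gaussLogSum hx (Nat.le_succ _)

theorem limsup_eq_of_forall_eventually_frequently {u : ℕ → ℝ} {b : ℝ}
    (h1 : ∀ ε > 0, ∀ᶠ n in atTop, u n ≤ b + ε) (h2 : ∀ ε > 0, ∃ᶠ n in atTop, b - ε ≤ u n) :
    limsup u atTop = b := by
  have hb : IsBoundedUnder (· ≤ ·) atTop u := isBoundedUnder_of_eventually_le (h1 1 one_pos)
  have hc : IsCoboundedUnder (· ≤ ·) atTop u :=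
    IsCoboundedUnder.of_frequently_ge (h2 1 one_pos)
  refine le_antisymm (le_of_forall_pos_le_add fun ε hε => limsup_le_of_le hc (h1 ε hε))
    (le_of_forall_pos_le_add fun ε hε => ?_)
  linarith [le_limsup_of_frequently_le (h2 ε hε) hb]

theorem liminf_eq_of_forall_eventually_frequently {u : ℕ → ℝ} {b : ℝ}
    (h1 : ∀ ε > 0, ∀ᶠ n in atTop, b - ε ≤ u n) (h2 : ∀ ε > 0, ∃ᶠ n in atTop, u n ≤ b + ε) :
    liminf u atTop = b := by
  have hb : IsBoundedUnder (· ≥ ·) atTop u := isBoundedUnder_of_eventually_ge (h1 1 one_pos)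
  have hc : IsCoboundedUnder (· ≥ ·) atTop u :=
    IsCoboundedUnder.of_frequently_le (h2 1 one_pos)
  refine le_antisymm (le_of_forall_pos_le_add fun ε hε => liminf_le_of_frequently_le (h2 ε hε) hb)
    (le_of_forall_pos_le_add fun ε hε => ?_)
  linarith [le_liminf_of_le hc (h1 ε hε)]

theorem tendsto_log_mul_log_div_log {δ : ℝ} (hδ : 0 < δ) :
    Tendsto (fun k : ℕ => Real.log (δ * (k * Real.log k / Real.log 2)) / Real.log k) atTop
      (nhds 1) := by
  have hlog : Tendsto (fun k : ℕ => Real.log k) atTop atTop :=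
    Real.tendsto_log_atTop.comp tendsto_natCast_atTop_atTop
  have h1 : Tendsto (fun k : ℕ => Real.log (Real.log k) / Real.log k) atTop (nhds 0) :=
    Real.isLittleO_log_id_atTop.tendsto_div_nhds_zero.comp hlog
  have h2 : Tendsto (fun k : ℕ => Real.log (δ / Real.log 2) / Real.log k) atTop (nhds 0) :=
    hlog.const_div_atTop _
  have h3 := (h1.add h2).add_const 1
  rw [add_zero, zero_add] at h3
  refine h3.congr' ?_
  filter_upwards [hlog.eventually_gt_atTop 0, eventually_gt_atTop 0] with k hk hk0
  have hl := Real.log_pos one_lt_two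
  have hk' : (0 : ℝ) < k := by exact_mod_cast hk0
  rw [show δ * (k * Real.log k / Real.log 2) = δ / Real.log 2 * (k * Real.log k) by ring,
    Real.log_mul (by positivity) (by positivity), Real.log_mul (by positivity) (by positivity)]
  field_simp
  ring

theorem tendsto_mul_log_atTop {δ : ℝ} (hδ : 0 < δ) :
    Tendsto (fun k : ℕ => δ * (k * Real.log k / Real.log 2)) atTop atTop :=
  (((tendsto_natCast_atTop_atTop (R := ℝ)).atTop_mul_atTop₀
    (Real.tendsto_log_atTop.comp tendsto_natCast_atTop_atTop)).atTop_div_const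
    (Real.log_pos one_lt_two)).const_mul_atTop hδ

theorem tendsto_log_div_self_mul {L : ℕ → ℝ} {c δ : ℝ} (hδ : 0 < δ)
    (hL : Tendsto (fun n : ℕ => L n / n) atTop (nhds c)) (r : ℕ) :
    Tendsto (fun k : ℕ => Real.log (δ * (k * Real.log k / Real.log 2)) /
      (δ * (k * Real.log k / Real.log 2)) * L (2 * k + r)) atTop
      (nhds (2 * c * Real.log 2 / δ)) := by
  have hidx : Tendsto (fun k : ℕ => 2 * k + r) atTop atTop :=
    tendsto_atTop_mono (fun k => show k ≤ 2 * k + r by omega) tendsto_id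
  have h1 : Tendsto (fun k : ℕ => ((2 * k + r : ℕ) : ℝ) / k) atTop (nhds 2) := by
    have := ((tendsto_const_div_atTop_nhds_zero_nat (r : ℝ)).const_add 2)
    rw [add_zero] at this
    refine this.congr' ?_
    filter_upwards [eventually_gt_atTop 0] with k hk
    push_cast
    field_simp
  have h2 := (((tendsto_log_mul_log_div_log hδ).mul ((hL.comp hidx).mul h1)).mul_const
    (Real.log 2 / δ))
  rw [show 1 * (c * 2) * (Real.log 2 / δ) = 2 * c * Real.log 2 / δ by ring] at h2
  refine h2.congr' ?_
  filter_upwards [eventually_gt_atTop 1] with k hk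
  have hk' : (1 : ℝ) < k := by exact_mod_cast hk
  have hlk := Real.log_pos hk'
  have hl := Real.log_pos one_lt_two
  have hr : ((2 * k + r : ℕ) : ℝ) ≠ 0 := by
    have : 2 * k + r ≠ 0 := by omega
    exact_mod_cast this
  simp only [Function.comp_apply]
  field_simp

theorem log_div_self_mul_le {s t a b : ℝ} (hs : Real.exp 1 ≤ s) (hst : s ≤ t) (hb : 0 ≤ b)
    (hab : b ≤ a) : Real.log t / t * b ≤ Real.log s / s * a := by
  have h1 : Real.log t / t ≤ Real.log s / s :=
    Real.log_div_self_antitoneOn hs (hs.trans hst) hst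
  have h2 : 0 ≤ Real.log s / s := by
    have : 1 ≤ s := (Real.one_le_exp zero_le_one).trans hs
    exact div_nonneg (Real.log_nonneg this) (by linarith)
  exact mul_le_mul h1 hab hb h2

theorem eventually_log_div_mul_le {S : ℕ → ℕ} {L A : ℕ → ℝ} {c : ℝ} (hc : 0 < c)
    (hS : StrictMono S) (hex : ∀ n, ∃ k, S k ≤ n ∧ n < S (k + 1))
    (hge : ∀ δ : ℝ, δ < 1 → ∀ᶠ k : ℕ in atTop, δ * (k * Real.log k / Real.log 2) ≤ S k)
    (hL : Tendsto (fun n : ℕ => L n / n) atTop (nhds c)) (hA0 : ∀ n, 0 ≤ A n)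
    (hA : ∀ k n, n < S k → A n ≤ L (2 * k + 1)) {ε : ℝ} (hε : 0 < ε) :
    ∀ᶠ n : ℕ in atTop, Real.log n / n * A n ≤ 2 * c * Real.log 2 + ε := by
  have hl := Real.log_pos one_lt_two
  have hb : 0 < 2 * c * Real.log 2 := by positivity
  set b := 2 * c * Real.log 2 with hbdef
  have hδ : 0 < b / (b + ε / 2) := by positivity
  have hδ1 : b / (b + ε / 2) < 1 := (div_lt_one (by positivity)).2 (by linarith)
  have hlim := tendsto_log_div_self_mul hδ hL 3
  have hlt : b / (b / (b + ε / 2)) < b + ε := by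
    rw [div_div_cancel₀ hb.ne']; linarith
  obtain ⟨K, hK⟩ := eventually_atTop.1 ((hge _ hδ1).and ((hlim.eventually_lt_const hlt).and
    ((tendsto_mul_log_atTop hδ).eventually_ge_atTop (Real.exp 1))))
  filter_upwards [eventually_ge_atTop (S K)] with n hn
  obtain ⟨k, h1, h2⟩ := hex n
  have hk : K ≤ k := by
    by_contra hlt
    have : S (k + 1) ≤ S K := hS.monotone (by omega)
    omega
  obtain ⟨h3, h4, h5⟩ := hK k hk
  have h6 := hA (k + 1) n h2
  exact (log_div_self_mul_le h5 (h3.trans (by exact_mod_cast h1)) (hA0 n) h6).trans h4.le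

theorem frequently_le_log_div_mul {S : ℕ → ℕ} {L A : ℕ → ℝ} {c : ℝ} (hc : 0 < c)
    (hS : StrictMono S)
    (hle : ∀ δ : ℝ, 1 < δ → ∃ᶠ k : ℕ in atTop, (S k : ℝ) ≤ δ * (k * Real.log k / Real.log 2))
    (hL : Tendsto (fun n : ℕ => L n / n) atTop (nhds c)) (hL0 : ∀ n, 0 ≤ L n)
    (hA : ∀ k, L (2 * k) ≤ A (S k)) {ε : ℝ} (hε : 0 < ε) :
    ∃ᶠ n : ℕ in atTop, 2 * c * Real.log 2 - ε ≤ Real.log n / n * A n := by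
  have hl := Real.log_pos one_lt_two
  have hb : 0 < 2 * c * Real.log 2 := by positivity
  set b := 2 * c * Real.log 2 with hbdef
  have hδ1 : 1 < (b + ε) / b := (one_lt_div hb).2 (by linarith)
  have hδ : 0 < (b + ε) / b := by positivity
  have hlim := tendsto_log_div_self_mul hδ hL 0
  have hlt : b - ε < b / ((b + ε) / b) := by
    rw [div_div_eq_mul_div, lt_div_iff₀ (by positivity)]
    nlinarith
  refine hS.tendsto_atTop.frequently (((hle _ hδ1).and_eventually
    ((hlim.eventually_const_lt hlt).and
    ((tendsto_natCast_atTop_atTop.comp hS.tendsto_atTop).eventually_ge_atTop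
      (Real.exp 1)))).mono ?_)
  rintro k ⟨h1, h2, h3⟩
  exact h2.le.trans (log_div_self_mul_le h3 h1 (hL0 _) (hA k))

theorem gaussLogSum_nonneg {x : ℝ} (hx : ∀ i, gaussMap^[i] x ∈ Set.Ioo (0 : ℝ) 1) (n : ℕ) :
    0 ≤ gaussLogSum x n :=
  Finset.sum_nonneg fun i _ => neg_log_nonneg (hx i)

/-- For a.e. irrational `x ∈ (0,1)`:
`limsup (log n / n) log Qₙ = π²/6` and `liminf (log n / n) log |x - Pₙ/Qₙ| = -π²/3`. -/
theorem negCF_limsup_liminf_values :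
    ∀ᵐ x ∂(volume.restrict (Set.Ioo (0 : ℝ) 1)), Irrational x →
      Filter.limsup (fun n : ℕ => Real.log n / n * Real.log (negQ x (n + 1))) atTop
          = Real.pi ^ 2 / 6 ∧
      Filter.liminf (fun n : ℕ =>
          Real.log n / n * Real.log |x - (negP x (n + 1) : ℝ) / (negQ x (n + 1) : ℝ)|)
        atTop = -(Real.pi ^ 2 / 3) := by
  have hl := Real.log_pos one_lt_two
  apply ae_of_ae_gaussMeasure
  filter_upwards [ae_iterate_mem, ae_tendsto_gaussLogSum_div, ae_eventually_oddDigitSum_ge,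
    ae_frequently_oddDigitSum_le] with x hx hL hge hle _
  have hc : 0 < Real.pi ^ 2 / (12 * Real.log 2) := by positivity
  have hb : 2 * (Real.pi ^ 2 / (12 * Real.log 2)) * Real.log 2 = Real.pi ^ 2 / 6 := by
    field_simp
    norm_num
  have hS := strictMono_oddDigitSum hx
  have hex := exists_oddDigitSum_le_lt hx
  have hQ0 (n : ℕ) : 0 ≤ Real.log (negQ x (n + 1)) :=
    (log_negTailDenom_nonneg hx n).trans
      (Real.log_le_log (negTailDenom_pos hx _) (negTailDenom_le_negQ hx n))
  constructor
  · refine limsup_eq_of_forall_eventually_frequently (fun ε hε => ?_) (fun ε hε => ?_)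
    · rw [← hb]
      exact eventually_log_div_mul_le hc hS hex hge hL hQ0 (fun k n hn => log_negQ_le hx hn.le) hε
    · rw [← hb]
      exact frequently_le_log_div_mul hc hS hle hL (gaussLogSum_nonneg hx)
        (fun k => gaussLogSum_le_log_negQ hx le_rfl) hε
  · set A : ℕ → ℝ := fun n =>
      (Real.log (negQ x (n + 1)) + Real.log (negTailDenom x (n + 1))) / 2 with hA
    have hlog (n : ℕ) : Real.log |x - (negP x (n + 1) : ℝ) / (negQ x (n + 1) : ℝ)| =
        -2 * A n := by
      rw [log_abs_sub_negP_div_negQ hx, hA]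
      ring
    have hA0 (n : ℕ) : 0 ≤ A n := by
      have := hQ0 n
      have := log_negTailDenom_nonneg hx (n + 1)
      positivity
    simp_rw [hlog]
    refine liminf_eq_of_forall_eventually_frequently (fun ε hε => ?_) (fun ε hε => ?_)
    · filter_upwards [eventually_log_div_mul_le hc hS hex hge hL hA0 (fun k n hn => by
        simp only [hA]
        linarith [log_negQ_le hx hn.le, log_negTailDenom_le hx (Nat.succ_le_of_lt hn)])
        (half_pos hε)] with n hn
      rw [hb] at hn
      linarith
    · refine (frequently_le_log_div_mul hc hS hle hL (gaussLogSum_nonneg hx) (A := A) (fun k => ?_)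
        (half_pos hε)).mono fun n hn => ?_
      · simp only [hA]
        linarith [gaussLogSum_le_log_negQ hx (le_refl (oddDigitSum x k)),
          gaussLogSum_le_log_negTailDenom hx (Nat.le_succ (oddDigitSum x k))]
      · rw [hb] at hn
        linarith
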